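/- arXiv:1509.07001 — 2 statements merged into one kernel-verified Lean document; each statement's English description precedes it below -/
import Mathlib

section
/- Let (X,d) be a complete, simply-connected metric space equipped with a convex local geodesic bicombing σ, and let d̄ denote the induced length metric on X. Then (X,d̄) admits a convex geodesic bicombing σ̃ that is consistent with σ, i.e. each curve σ̃_{xy} : [0,1] → X, viewed as a map into (X,d), is a local geodesic consistent with σ. -/
open Set Metric

/-- `c : [0,1] → X` is a geodesic: `d(c s, c t) = |s - t| ⬝ d(c 0, c 1)` for `s, t ∈ [0,1]`. -/
def IsGeodesicSegment {X : Type*} [MetricSpace X] (c : ℝ → X) : Prop :=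
  ∀ s ∈ Icc (0:ℝ) 1, ∀ t ∈ Icc (0:ℝ) 1,
    dist (c s) (c t) = |s - t| * dist (c 0) (c 1)

/-- A local geodesic bicombing on a metric space `X`: an assignment `x ↦ r x > 0` and a
selection `σ y z` of geodesics from `y` to `z` for pairs `y, z` lying in a common ball
`U(x, r x)`, staying in that ball, and consistent with taking subsegments. -/
structure LocalGeodesicBicombing (X : Type*) [MetricSpace X] where
  r : X → ℝ
  r_pos : ∀ x, 0 < r x
  σ : X → X → ℝ → X
  source : ∀ x y z, y ∈ ball x (r x) → z ∈ ball x (r x) → σ y z 0 = y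
  target : ∀ x y z, y ∈ ball x (r x) → z ∈ ball x (r x) → σ y z 1 = z
  geodesic : ∀ x y z, y ∈ ball x (r x) → z ∈ ball x (r x) →
    ∀ s ∈ Icc (0:ℝ) 1, ∀ t ∈ Icc (0:ℝ) 1, dist (σ y z s) (σ y z t) = |s - t| * dist y z
  mem_ball : ∀ x y z, y ∈ ball x (r x) → z ∈ ball x (r x) →
    ∀ t ∈ Icc (0:ℝ) 1, σ y z t ∈ ball x (r x)
  consistent : ∀ x y z, y ∈ ball x (r x) → z ∈ ball x (r x) →
    ∀ a b, 0 ≤ a → a ≤ b → b ≤ 1 → ∀ t ∈ Icc (0:ℝ) 1,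
      σ (σ y z a) (σ y z b) t = σ y z ((1 - t) * a + t * b)

namespace LocalGeodesicBicombing

variable {X : Type*} [MetricSpace X]

/-- The domain `U` of the local bicombing: pairs of points lying in a common ball `U(x, r x)`. -/
def InDom (L : LocalGeodesicBicombing X) (y z : X) : Prop :=
  ∃ x, y ∈ ball x (L.r x) ∧ z ∈ ball x (L.r x)

/-- A local geodesic bicombing is convex if it is locally convex. -/
def IsConvex (L : LocalGeodesicBicombing X) : Prop :=
  ∀ x, ∀ y ∈ ball x (L.r x), ∀ z ∈ ball x (L.r x), ∀ y' ∈ ball x (L.r x), ∀ z' ∈ ball x (L.r x),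
    ConvexOn ℝ (Icc (0:ℝ) 1) (fun t => dist (L.σ y z t) (L.σ y' z' t))

/-- A local geodesic bicombing is reversible if `σ z y (t) = σ y z (1 - t)` on its domain. -/
def IsReversible (L : LocalGeodesicBicombing X) : Prop :=
  ∀ y z, L.InDom y z → ∀ t ∈ Icc (0:ℝ) 1, L.σ z y t = L.σ y z (1 - t)

end LocalGeodesicBicombing

/-- The length `L(γ)` of a curve `γ : [0,1] → X` (as a real number; the supremum over
partitions of `[0,1]` of the sums of consecutive distances). -/
noncomputable def curveLength {X : Type*} [MetricSpace X] (γ : ℝ → X) : ℝ :=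
  (eVariationOn γ (Icc (0:ℝ) 1)).toReal

/-- `c : [0,1] → X` is a local geodesic: every `t ∈ [0,1]` has a neighborhood in `[0,1]` on
which `d(c s, c s') = |s - s'| ⬝ L(c)`. -/
def IsLocalGeodesic {X : Type*} [MetricSpace X] (c : ℝ → X) : Prop :=
  ∀ t ∈ Icc (0:ℝ) 1, ∃ ε > (0:ℝ),
    ∀ s ∈ Icc (0:ℝ) 1 ∩ Ioo (t - ε) (t + ε), ∀ s' ∈ Icc (0:ℝ) 1 ∩ Ioo (t - ε) (t + ε),
      dist (c s) (c s') = |s - s'| * curveLength c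

/-- A curve `c : [0,1] → X` is consistent with the local geodesic bicombing `L` if
`c ((1-t)a + tb) = σ (c a) (c b) t` whenever `0 ≤ a ≤ b ≤ 1` and `(c a, c b)` is in the
domain of `L`. -/
def LocalGeodesicBicombing.ConsistentWith {X : Type*} [MetricSpace X]
    (L : LocalGeodesicBicombing X) (c : ℝ → X) : Prop :=
  ∀ a b, 0 ≤ a → a ≤ b → b ≤ 1 → L.InDom (c a) (c b) →
    ∀ t ∈ Icc (0:ℝ) 1, c ((1 - t) * a + t * b) = L.σ (c a) (c b) t

/-- The induced length metric `d̄(x,y)`: the infimum of lengths of continuous curves from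
`x` to `y`. -/
noncomputable def lengthMetric {X : Type*} [MetricSpace X] (x y : X) : ℝ :=
  (⨅ (γ : ℝ → X) (_ : ContinuousOn γ (Icc (0:ℝ) 1)) (_ : γ 0 = x) (_ : γ 1 = y),
    eVariationOn γ (Icc (0:ℝ) 1)).toReal

/-- `σ'` is a convex geodesic bicombing on `(X, d̄)` (where `d̄` is the induced length metric)
which is consistent with the local geodesic bicombing `L` on `(X, d)`: each `σ' x y` is a
geodesic from `x` to `y` with respect to `d̄`, the selection is consistent with taking
subsegments, the function `t ↦ d̄(σ' x y t, σ' x' y' t)` is convex on `[0,1]`, and each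
`σ' x y`, viewed as a map into `(X, d)`, is a local geodesic consistent with `L`. -/
structure IsConsistentConvexBicombing {X : Type*} [MetricSpace X]
    (L : LocalGeodesicBicombing X) (σ' : X → X → ℝ → X) : Prop where
  source : ∀ x y, σ' x y 0 = x
  target : ∀ x y, σ' x y 1 = y
  geodesic : ∀ x y, ∀ s ∈ Icc (0:ℝ) 1, ∀ t ∈ Icc (0:ℝ) 1,
    lengthMetric (σ' x y s) (σ' x y t) = |s - t| * lengthMetric x y
  consistent : ∀ x y a b, 0 ≤ a → a ≤ b → b ≤ 1 → ∀ t ∈ Icc (0:ℝ) 1,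
    σ' (σ' x y a) (σ' x y b) t = σ' x y ((1 - t) * a + t * b)
  convex : ∀ x y x' y', ConvexOn ℝ (Icc (0:ℝ) 1)
    (fun t => lengthMetric (σ' x y t) (σ' x' y' t))
  localGeodesic : ∀ x y, IsLocalGeodesic (σ' x y)
  consistentWith : ∀ x y, L.ConsistentWith (σ' x y)

/-- A continuous function on an interval that is locally midpoint-convex and nonpositive at the
endpoints is nonpositive. -/
theorem nonpos_of_locally_midpoint_le {f : ℝ → ℝ} {a b : ℝ} (hf : ContinuousOn f (Icc a b))
    (ha : f a ≤ 0) (hb : f b ≤ 0)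
    (hloc : ∀ t ∈ Ioo a b, ∃ ε > 0, ∀ δ, 0 < δ → δ < ε → 2 * f t ≤ f (t - δ) + f (t + δ)) :
    ∀ t ∈ Icc a b, f t ≤ 0 := by
  intro t ht
  obtain ⟨m, hm, hmax⟩ := isCompact_Icc.exists_isMaxOn ⟨t, ht⟩ hf
  by_contra! hpos
  have hK : IsCompact (Icc a b ∩ f ⁻¹' {f m}) :=
    isCompact_Icc.of_isClosed_subset
      (hf.preimage_isClosed_of_isClosed isClosed_Icc isClosed_singleton) inter_subset_left
  obtain ⟨k, ⟨hk, hfk⟩, hleast⟩ := hK.exists_isLeast ⟨m, hm, rfl⟩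
  have hfk : f k = f m := hfk
  have hfm : 0 < f m := hpos.trans_le (hmax ht)
  have hka : a < k := lt_of_le_of_ne hk.1 (by rintro rfl; linarith)
  have hkb : k < b := lt_of_le_of_ne hk.2 (by rintro rfl; linarith)
  obtain ⟨ε, hε, h⟩ := hloc k ⟨hka, hkb⟩
  set δ := min (ε / 2) (min (k - a) (b - k)) with hδ
  have hδ0 : 0 < δ := lt_min (by linarith) (lt_min (by linarith) (by linarith))
  have hδ1 : δ ≤ ε / 2 := min_le_left _ _
  have hδ2 : δ ≤ k - a := (min_le_right _ _).trans (min_le_left _ _)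
  have hδ3 : δ ≤ b - k := (min_le_right _ _).trans (min_le_right _ _)
  have h1 := h δ hδ0 (by linarith)
  have hmem : k - δ ∈ Icc a b := ⟨by linarith, by linarith⟩
  have h2 : f (k - δ) ≤ f m := hmax hmem
  have h3 : f (k + δ) ≤ f m := hmax (show k + δ ∈ Icc a b from ⟨by linarith, by linarith⟩)
  have h4 : f (k - δ) ≠ f m := fun h => by
    have := hleast ⟨hmem, h⟩
    linarith
  have := lt_of_le_of_ne h2 h4
  linarith

theorem convexOn_of_locally_midpoint_le {f : ℝ → ℝ} {a b : ℝ} (hf : ContinuousOn f (Icc a b))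
    (hloc : ∀ t ∈ Ioo a b, ∃ ε > 0, ∀ δ, 0 < δ → δ < ε → 2 * f t ≤ f (t - δ) + f (t + δ)) :
    ConvexOn ℝ (Icc a b) f := by
  refine LinearOrder.convexOn_of_lt (convex_Icc a b) ?_
  intro x hx y hy hxy p q hp hq hpq
  have hsub : Icc x y ⊆ Icc a b := Icc_subset_Icc hx.1 hy.2
  have hxy' : y - x ≠ 0 := by linarith
  have key := nonpos_of_locally_midpoint_le (a := x) (b := y)
    (f := fun t => f t - (f x + (t - x) * ((f y - f x) / (y - x))))
    ((hf.mono hsub).sub (by fun_prop)) (by simp) (by field_simp; simp) (by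
      intro t ht
      obtain ⟨ε, hε, h⟩ := hloc t ⟨hx.1.trans_lt ht.1, ht.2.trans_le hy.2⟩
      refine ⟨ε, hε, fun δ h0 h1 => ?_⟩
      have := h δ h0 h1
      linarith) (p • x + q • y) (convex_Icc x y ⟨le_rfl, hxy.le⟩ ⟨hxy.le, le_rfl⟩ hp.le hq.le hpq)
  have e : p • x + q • y - x = q * (y - x) := by
    simp only [smul_eq_mul]; linear_combination x * hpq
  rw [e] at key
  have e2 : q * (y - x) * ((f y - f x) / (y - x)) = q * (f y - f x) := by field_simp
  rw [e2] at key
  simp only [smul_eq_mul] at key ⊢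
  have : p = 1 - q := by linarith
  subst this
  linarith

namespace LocalGeodesicBicombing

variable {X : Type*} [MetricSpace X] {L : LocalGeodesicBicombing X}

theorem InDom.refl (L : LocalGeodesicBicombing X) (x : X) : L.InDom x x :=
  ⟨x, mem_ball_self (L.r_pos x), mem_ball_self (L.r_pos x)⟩

theorem InDom.source {y z : X} (h : L.InDom y z) : L.σ y z 0 = y := by
  obtain ⟨x, hy, hz⟩ := h
  exact L.source x y z hy hz

theorem InDom.target {y z : X} (h : L.InDom y z) : L.σ y z 1 = z := by
  obtain ⟨x, hy, hz⟩ := h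
  exact L.target x y z hy hz

theorem InDom.dist_eq {y z : X} (h : L.InDom y z) {s t : ℝ} (hs : s ∈ Icc (0 : ℝ) 1)
    (ht : t ∈ Icc (0 : ℝ) 1) : dist (L.σ y z s) (L.σ y z t) = |s - t| * dist y z := by
  obtain ⟨x, hy, hz⟩ := h
  exact L.geodesic x y z hy hz s hs t ht

/-- A curve is locally consistent with `L` if every parameter has a neighbourhood on which the
curve follows the geodesics selected by `L`. -/
def IsLocallyConsistent (L : LocalGeodesicBicombing X) (c : ℝ → X) : Prop :=
  ∀ t ∈ Icc (0 : ℝ) 1, ∃ ε > 0, ∀ a ∈ Icc (0 : ℝ) 1 ∩ Ioo (t - ε) (t + ε),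
    ∀ b ∈ Icc (0 : ℝ) 1 ∩ Ioo (t - ε) (t + ε), a ≤ b →
      L.InDom (c a) (c b) ∧ ∀ s ∈ Icc (0 : ℝ) 1, c ((1 - s) * a + s * b) = L.σ (c a) (c b) s

theorem affine_mem_Icc {a b p q s : ℝ} (ha : a ∈ Icc p q) (hb : b ∈ Icc p q)
    (hs : s ∈ Icc (0 : ℝ) 1) : (1 - s) * a + s * b ∈ Icc p q :=
  convex_Icc p q ha hb (sub_nonneg.2 hs.2) hs.1 (by ring)

theorem exists_eq_affine {a b u : ℝ} (hu : u ∈ Icc a b) :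
    ∃ s ∈ Icc (0 : ℝ) 1, u = (1 - s) * a + s * b := by
  rcases (hu.1.trans hu.2).eq_or_lt with rfl | hab
  · exact ⟨0, by simp, by simpa using le_antisymm hu.2 hu.1⟩
  · have h : b - a ≠ 0 := by linarith
    have h' : 0 < b - a := by linarith
    refine ⟨(u - a) / (b - a), ⟨div_nonneg (by linarith [hu.1]) h'.le,
      (div_le_one h').2 (by linarith [hu.2])⟩, ?_⟩
    field_simp
    ring

/-- A curve which follows a geodesic of `L` on `[a, b]` has constant speed there. -/
theorem InDom.dist_eq_of_affine {c : ℝ → X} {a b : ℝ} (hab : a < b) (h : L.InDom (c a) (c b))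
    (hc : ∀ s ∈ Icc (0 : ℝ) 1, c ((1 - s) * a + s * b) = L.σ (c a) (c b) s)
    {u v : ℝ} (hu : u ∈ Icc a b) (hv : v ∈ Icc a b) :
    dist (c u) (c v) = |u - v| * (dist (c a) (c b) / (b - a)) := by
  obtain ⟨s, hs, rfl⟩ := exists_eq_affine hu
  obtain ⟨t, ht, rfl⟩ := exists_eq_affine hv
  rw [hc s hs, hc t ht, h.dist_eq hs ht,
    show (1 - s) * a + s * b - ((1 - t) * a + t * b) = (s - t) * (b - a) by ring, abs_mul,
    abs_of_pos (sub_pos.2 hab)]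
  have : b - a ≠ 0 := by linarith
  field_simp

namespace IsLocallyConsistent

variable {c c' : ℝ → X}

theorem exists_speed (hc : L.IsLocallyConsistent c) {t : ℝ} (ht : t ∈ Icc (0 : ℝ) 1) :
    ∃ l ≥ 0, ∃ ε > 0, ∀ u ∈ Icc (0 : ℝ) 1 ∩ Ioo (t - ε) (t + ε),
      ∀ v ∈ Icc (0 : ℝ) 1 ∩ Ioo (t - ε) (t + ε), dist (c u) (c v) = |u - v| * l := by
  obtain ⟨ε, hε, h⟩ := hc t ht
  have ha : max 0 (t - ε / 2) ∈ Icc (0 : ℝ) 1 ∩ Ioo (t - ε) (t + ε) :=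
    ⟨⟨le_max_left _ _, max_le zero_le_one (by linarith [ht.2])⟩,
      lt_max_of_lt_right (by linarith), max_lt (by linarith [ht.1]) (by linarith)⟩
  have hb : min 1 (t + ε / 2) ∈ Icc (0 : ℝ) 1 ∩ Ioo (t - ε) (t + ε) :=
    ⟨⟨le_min zero_le_one (by linarith [ht.1]), min_le_left _ _⟩,
      lt_min (by linarith [ht.2]) (by linarith), min_lt_of_right_lt (by linarith)⟩
  have hab : max 0 (t - ε / 2) < min 1 (t + ε / 2) :=
    max_lt (lt_min one_pos (by linarith [ht.1])) (lt_min (by linarith [ht.2]) (by linarith))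
  obtain ⟨h1, h2⟩ := h _ ha _ hb hab.le
  refine ⟨dist (c (max 0 (t - ε / 2))) (c (min 1 (t + ε / 2))) / _,
    div_nonneg dist_nonneg (sub_nonneg.2 hab.le), ε / 2, half_pos hε, ?_⟩
  intro u hu v hv
  exact h1.dist_eq_of_affine hab h2
    ⟨max_le hu.1.1 hu.2.1.le, le_min hu.1.2 hu.2.2.le⟩
    ⟨max_le hv.1.1 hv.2.1.le, le_min hv.1.2 hv.2.2.le⟩

theorem continuousOn (hc : L.IsLocallyConsistent c) : ContinuousOn c (Icc 0 1) := by
  intro t ht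
  obtain ⟨l, hl, ε, hε, h⟩ := hc.exists_speed ht
  have hmem : Icc (0 : ℝ) 1 ∩ Ioo (t - ε) (t + ε) ∈ nhdsWithin t (Icc 0 1) :=
    inter_mem_nhdsWithin _ (Ioo_mem_nhds (by linarith) (by linarith))
  rw [ContinuousWithinAt, tendsto_iff_dist_tendsto_zero]
  have hlim : Filter.Tendsto (fun u => |u - t| * l) (nhdsWithin t (Icc 0 1)) (nhds 0) := by
    have : Continuous fun u : ℝ => |u - t| * l := by fun_prop
    simpa using (this.tendsto t).mono_left nhdsWithin_le_nhds
  refine hlim.congr' ?_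
  filter_upwards [hmem] with u hu
  exact (h u hu t ⟨ht, by simpa using hε⟩).symm

theorem congr (hc : L.IsLocallyConsistent c) (h : EqOn c c' (Icc 0 1)) :
    L.IsLocallyConsistent c' := by
  intro t ht
  obtain ⟨ε, hε, H⟩ := hc t ht
  refine ⟨ε, hε, fun a ha b hb hab => ?_⟩
  rw [← h ha.1, ← h hb.1]
  refine ⟨(H a ha b hb hab).1, fun s hs => ?_⟩
  rw [← h (affine_mem_Icc ha.1 hb.1 hs)]
  exact (H a ha b hb hab).2 s hs

theorem restrict (hc : L.IsLocallyConsistent c) {a b : ℝ} (ha : 0 ≤ a) (hab : a ≤ b)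
    (hb : b ≤ 1) : L.IsLocallyConsistent fun s => c ((1 - s) * a + s * b) := by
  have haI : a ∈ Icc (0 : ℝ) 1 := ⟨ha, hab.trans hb⟩
  have hbI : b ∈ Icc (0 : ℝ) 1 := ⟨ha.trans hab, hb⟩
  intro t ht
  obtain ⟨ε, hε, H⟩ := hc _ (affine_mem_Icc haI hbI ht)
  have key : ∀ u ∈ Icc (0 : ℝ) 1 ∩ Ioo (t - ε) (t + ε), (1 - u) * a + u * b ∈ Icc (0 : ℝ) 1 ∩
      Ioo ((1 - t) * a + t * b - ε) ((1 - t) * a + t * b + ε) := by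
    intro u hu
    refine ⟨affine_mem_Icc haI hbI hu.1, ?_⟩
    have h1 : |u - t| < ε := abs_lt.2 ⟨by linarith [hu.2.1], by linarith [hu.2.2]⟩
    have h2 : |(u - t) * (b - a)| < ε := by
      rw [abs_mul]
      refine (mul_le_of_le_one_right (abs_nonneg _) ?_).trans_lt h1
      rw [abs_of_nonneg (by linarith)]
      linarith
    have h3 := abs_lt.1 h2
    constructor <;> nlinarith [h3.1, h3.2]
  refine ⟨ε, hε, fun u hu v hv huv => ?_⟩
  obtain ⟨h1, h2⟩ := H _ (key u hu) _ (key v hv) (by nlinarith)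
  refine ⟨h1, fun s hs => ?_⟩
  rw [← h2 s hs]
  exact congrArg c (by ring)

/-- Two locally consistent curves which are pointwise close have convex distance. -/
theorem convexOn_dist (hL : L.IsConvex) (hc : L.IsLocallyConsistent c)
    (hc' : L.IsLocallyConsistent c') (h : ∀ t ∈ Icc (0 : ℝ) 1, L.InDom (c t) (c' t)) :
    ConvexOn ℝ (Icc 0 1) fun t => dist (c t) (c' t) := by
  refine convexOn_of_locally_midpoint_le
    (continuous_dist.comp_continuousOn (hc.continuousOn.prodMk hc'.continuousOn)) fun t ht => ?_
  have htI := Ioo_subset_Icc_self ht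
  obtain ⟨x, hx, hx'⟩ := h t htI
  obtain ⟨ε, hε, H⟩ := hc t htI
  obtain ⟨ε', hε', H'⟩ := hc' t htI
  have hn : Icc (0 : ℝ) 1 ∈ nhds t := Icc_mem_nhds ht.1 ht.2
  have e1 := (hc.continuousOn.continuousAt hn).eventually (isOpen_ball.mem_nhds hx)
  have e2 := (hc'.continuousOn.continuousAt hn).eventually (isOpen_ball.mem_nhds hx')
  obtain ⟨η, hη, hb⟩ := Metric.eventually_nhds_iff.1 ((e1.and e2).and hn)
  refine ⟨min η (min ε ε'), by positivity, fun δ h0 h1 => ?_⟩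
  obtain ⟨h1, h2, h3⟩ : δ < η ∧ δ < ε ∧ δ < ε' := by simpa using h1
  obtain ⟨⟨b1, b1'⟩, m1⟩ := hb (y := t - δ) (by simpa [abs_of_pos h0])
  obtain ⟨⟨b2, b2'⟩, m2⟩ := hb (y := t + δ) (by simpa [abs_of_pos h0])
  have h5 : (1 / 2 : ℝ) ∈ Icc (0 : ℝ) 1 := by constructor <;> norm_num
  have A := (H (t - δ) ⟨m1, by constructor <;> linarith⟩ (t + δ)
    ⟨m2, by constructor <;> linarith⟩ (by linarith)).2 (1 / 2) h5
  have A' := (H' (t - δ) ⟨m1, by constructor <;> linarith⟩ (t + δ)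
    ⟨m2, by constructor <;> linarith⟩ (by linarith)).2 (1 / 2) h5
  obtain ⟨-, B⟩ := hL x _ b1 _ b2 _ b1' _ b2'
  replace B := B (left_mem_Icc.2 zero_le_one) (right_mem_Icc.2 zero_le_one)
    (show (0 : ℝ) ≤ 1 / 2 by norm_num) (show (0 : ℝ) ≤ 1 / 2 by norm_num) (by norm_num)
  simp only [smul_eq_mul, mul_zero, mul_one, zero_add] at B
  rw [← A, ← A', L.source x _ _ b1 b2, L.source x _ _ b1' b2', L.target x _ _ b1 b2,
    L.target x _ _ b1' b2', show (1 - 1 / 2) * (t - δ) + 1 / 2 * (t + δ) = t by ring] at B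
  linarith

theorem dist_le (hL : L.IsConvex) (hc : L.IsLocallyConsistent c)
    (hc' : L.IsLocallyConsistent c') (h : ∀ t ∈ Icc (0 : ℝ) 1, L.InDom (c t) (c' t))
    {t : ℝ} (ht : t ∈ Icc (0 : ℝ) 1) :
    dist (c t) (c' t) ≤ (1 - t) * dist (c 0) (c' 0) + t * dist (c 1) (c' 1) := by
  simpa using (hc.convexOn_dist hL hc' h).2 (left_mem_Icc.2 zero_le_one)
    (right_mem_Icc.2 zero_le_one) (sub_nonneg.2 ht.2) ht.1 (by ring)

end IsLocallyConsistent

theorem InDom.isLocallyConsistent {y z : X} (h : L.InDom y z) :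
    L.IsLocallyConsistent (L.σ y z) := by
  obtain ⟨x, hy, hz⟩ := h
  intro t _
  refine ⟨1, one_pos, fun a ha b hb hab => ⟨⟨x, L.mem_ball x y z hy hz a ha.1,
    L.mem_ball x y z hy hz b hb.1⟩, fun s hs => ?_⟩⟩
  exact (L.consistent x y z hy hz a b ha.1.1 hab hb.1.2 s hs).symm

theorem isLocallyConsistent_const (L : LocalGeodesicBicombing X) (x : X) :
    L.IsLocallyConsistent fun _ => x := by
  refine (InDom.refl L x).isLocallyConsistent.congr fun t ht => ?_
  have h := (InDom.refl L x).dist_eq ht (left_mem_Icc.2 zero_le_one)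
  rw [(InDom.refl L x).source, dist_self, mul_zero] at h
  exact dist_eq_zero.1 h

theorem dist_sigma_le (hL : L.IsConvex) {x y z y' z' : X} (hy : y ∈ ball x (L.r x))
    (hz : z ∈ ball x (L.r x)) (hy' : y' ∈ ball x (L.r x)) (hz' : z' ∈ ball x (L.r x))
    {t : ℝ} (ht : t ∈ Icc (0 : ℝ) 1) :
    dist (L.σ y z t) (L.σ y' z' t) ≤ (1 - t) * dist y y' + t * dist z z' := by
  have := (InDom.isLocallyConsistent (L := L) ⟨x, hy, hz⟩).dist_le hL
    (InDom.isLocallyConsistent (L := L) ⟨x, hy', hz'⟩)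
    (fun t ht => ⟨x, L.mem_ball x y z hy hz t ht, L.mem_ball x y' z' hy' hz' t ht⟩) ht
  rwa [L.source x y z hy hz, L.source x y' z' hy' hz', L.target x y z hy hz,
    L.target x y' z' hy' hz'] at this

namespace IsLocallyConsistent

variable {c c' : ℝ → X}

/-- A locally consistent curve inside one of the distinguished balls is the selected geodesic. -/
theorem eq_sigma_of_mem_ball (hL : L.IsConvex) (hc : L.IsLocallyConsistent c) {a b : ℝ}
    (ha : 0 ≤ a) (hab : a ≤ b) (hb : b ≤ 1) {x : X} (h : ∀ u ∈ Icc a b, c u ∈ ball x (L.r x))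
    {s : ℝ} (hs : s ∈ Icc (0 : ℝ) 1) : c ((1 - s) * a + s * b) = L.σ (c a) (c b) s := by
  have h1 := h a ⟨le_rfl, hab⟩
  have h2 := h b ⟨hab, le_rfl⟩
  have hd : L.InDom (c a) (c b) := ⟨x, h1, h2⟩
  have := (hc.restrict ha hab hb).dist_le hL hd.isLocallyConsistent (fun t ht => ⟨x,
    h _ (affine_mem_Icc ⟨le_rfl, hab⟩ ⟨hab, le_rfl⟩ ht), L.mem_ball x _ _ h1 h2 t ht⟩) hs
  rw [hd.source, hd.target] at this
  simp only [sub_zero, one_mul, zero_mul, add_zero, dist_self, mul_zero, sub_self, zero_add] at this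
  exact dist_le_zero.1 this

theorem exists_ball_subset (hc : L.IsLocallyConsistent c) :
    ∃ ρ > 0, ∀ t ∈ Icc (0 : ℝ) 1, ∃ x, ball (c t) ρ ⊆ ball x (L.r x) := by
  obtain ⟨ρ, hρ, h⟩ := lebesgue_number_lemma_of_metric
    (isCompact_Icc.image_of_continuousOn hc.continuousOn) (fun x : X => isOpen_ball (x := x)
      (ε := L.r x)) (fun y _ => mem_iUnion.2 ⟨y, mem_ball_self (L.r_pos y)⟩)
  exact ⟨ρ, hρ, fun t ht => h _ (mem_image_of_mem c ht)⟩

theorem exists_dist_lt (hc : L.IsLocallyConsistent c) {ε : ℝ} (hε : 0 < ε) :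
    ∃ δ > 0, ∀ s ∈ Icc (0 : ℝ) 1, ∀ t ∈ Icc (0 : ℝ) 1, |s - t| < δ → dist (c s) (c t) < ε := by
  obtain ⟨δ, hδ, h⟩ := Metric.uniformContinuousOn_iff.1
    (isCompact_Icc.uniformContinuousOn_of_continuous hc.continuousOn) ε hε
  exact ⟨δ, hδ, fun s hs t ht hst => h s hs t ht hst⟩

/-- Uniform limits of locally consistent curves are locally consistent. -/
theorem of_uniform_limit (hL : L.IsConvex) (hc : ContinuousOn c (Icc 0 1))
    (h : ∀ η > 0, ∃ c', L.IsLocallyConsistent c' ∧ ∀ t ∈ Icc (0 : ℝ) 1, dist (c' t) (c t) ≤ η) :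
    L.IsLocallyConsistent c := by
  intro t ht
  have hr := L.r_pos (c t)
  set r := L.r (c t) with hr_def
  obtain ⟨ε, hε, H⟩ := Metric.continuousWithinAt_iff.1 (hc t ht) (r / 2) (by linarith)
  have key : ∀ a ∈ Icc (0 : ℝ) 1 ∩ Ioo (t - ε) (t + ε), dist (c a) (c t) < r / 2 := fun a ha =>
    H ha.1 (abs_lt.2 ⟨by linarith [ha.2.1], by linarith [ha.2.2]⟩)
  have hmem : ∀ a ∈ Icc (0 : ℝ) 1 ∩ Ioo (t - ε) (t + ε), c a ∈ ball (c t) r := fun a ha =>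
    (key a ha).trans (by linarith)
  refine ⟨ε, hε, fun a ha b hb hab => ⟨⟨c t, hmem a ha, hmem b hb⟩, fun s hs => ?_⟩⟩
  refine dist_le_zero.1 (le_of_forall_pos_le_add fun η hη => ?_)
  obtain ⟨c', hc', hd⟩ := h (min (η / 2) (r / 4)) (by positivity)
  have hd1 : ∀ u ∈ Icc (0 : ℝ) 1, dist (c' u) (c u) ≤ η / 2 := fun u hu =>
    (hd u hu).trans (min_le_left _ _)
  have hmem' : ∀ u ∈ Icc (0 : ℝ) 1 ∩ Ioo (t - ε) (t + ε), c' u ∈ ball (c t) r := by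
    intro u hu
    have h1 := (hd u hu.1).trans (min_le_right _ _)
    have h2 := key u hu
    have h3 := dist_triangle (c' u) (c u) (c t)
    rw [Metric.mem_ball]
    linarith
  have e := hc'.eq_sigma_of_mem_ball hL ha.1.1 hab hb.1.2 (x := c t) (fun u hu => hmem' u
    ⟨⟨ha.1.1.trans hu.1, hu.2.trans hb.1.2⟩, ha.2.1.trans_le hu.1, hu.2.trans_lt hb.2.2⟩) hs
  have h1 := dist_sigma_le hL (hmem' a ha) (hmem' b hb) (hmem a ha) (hmem b hb) hs
  have h2 := hd1 _ (affine_mem_Icc ha.1 hb.1 hs)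
  rw [← e] at h1
  have h3 := mul_le_mul_of_nonneg_left (hd1 a ha.1) (sub_nonneg.2 hs.2)
  have h4 := mul_le_mul_of_nonneg_left (hd1 b hb.1) hs.1
  have h5 := dist_triangle_left (c ((1 - s) * a + s * b)) (L.σ (c a) (c b) s)
    (c' ((1 - s) * a + s * b))
  linarith

/-- Curves uniformly close to a given locally consistent curve are pointwise in the domain. -/
theorem exists_inDom_of_close (hc : L.IsLocallyConsistent c) : ∃ ρ > 0, ∀ t ∈ Icc (0 : ℝ) 1,
    ∀ y ∈ ball (c t) ρ, ∀ z ∈ ball (c t) ρ, L.InDom y z := by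
  obtain ⟨ρ, hρ, h⟩ := hc.exists_ball_subset
  refine ⟨ρ, hρ, fun t ht y hy z hz => ?_⟩
  obtain ⟨x, hx⟩ := h t ht
  exact ⟨x, hx hy, hx hz⟩

end IsLocallyConsistent

end LocalGeodesicBicombing

/-- A discrete Dirichlet problem: given a chain `q` which is a fixed point of the midpoint
operation `M`, any small perturbation of the endpoints extends to a fixed chain close to `q`. -/
theorem exists_midpoint_chain {X : Type*} [MetricSpace X] [CompleteSpace X] {n : ℕ}
    {q : ℕ → X} {M : X → X → X} {ε : ℝ}
    (hM : ∀ i, i + 2 ≤ n → ∀ y ∈ closedBall (q i) ε, ∀ z ∈ closedBall (q (i + 2)) ε,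
      ∀ y' ∈ closedBall (q i) ε, ∀ z' ∈ closedBall (q (i + 2)) ε,
      dist (M y z) (M y' z') ≤ (dist y y' + dist z z') / 2)
    (hq : ∀ i, i + 2 ≤ n → q (i + 1) = M (q i) (q (i + 2)))
    (hn : 0 < n) {x y : X} (hx : x ∈ closedBall (q 0) ε) (hy : y ∈ closedBall (q n) ε) :
    ∃ p : ℕ → X, p 0 = x ∧ (∀ i, n ≤ i → p i = y) ∧ (∀ i ≤ n, p i ∈ closedBall (q i) ε) ∧
      ∀ i, i + 2 ≤ n → p (i + 1) = M (p i) (p (i + 2)) := by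
  have hε : 0 ≤ ε := dist_nonneg.trans hx
  let T : (ℕ → X) → ℕ → X := fun p i => if 0 < i ∧ i < n then M (p (i - 1)) (p (i + 1)) else p i
  let P : ℕ → ℕ → X := fun k => T^[k] fun i => if i = 0 then x else if i < n then q i else y
  have hP0 : ∀ i, P 0 i = if i = 0 then x else if i < n then q i else y := fun i => rfl
  have hPs : ∀ k i, P (k + 1) i =
      if 0 < i ∧ i < n then M (P k (i - 1)) (P k (i + 1)) else P k i := by
    intro k i
    simp only [P, Function.iterate_succ_apply']
    rfl
  have hPint : ∀ k i, i + 2 ≤ n → P (k + 1) (i + 1) = M (P k i) (P k (i + 2)) := by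
    intro k i hi
    rw [hPs, if_pos ⟨by omega, by omega⟩]
    rfl
  have hPz : ∀ k, P k 0 = x := by
    intro k
    induction k with
    | zero => simp [hP0]
    | succ k ih => rw [hPs, if_neg (by omega), ih]
  have hPn : ∀ k i, n ≤ i → P k i = y := by
    intro k i hi
    induction k with
    | zero => rw [hP0, if_neg (by omega), if_neg (by omega)]
    | succ k ih => rw [hPs, if_neg (by omega), ih]
  have hcases : ∀ i ≤ n, i = 0 ∨ i = n ∨ ∃ j, i = j + 1 ∧ j + 2 ≤ n := by
    intro i hi
    rcases Nat.eq_zero_or_pos i with h | h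
    · exact Or.inl h
    rcases hi.eq_or_lt with h' | h'
    · exact Or.inr (Or.inl h')
    · exact Or.inr (Or.inr ⟨i - 1, by omega, by omega⟩)
  have hqself : ∀ i, q i ∈ closedBall (q i) ε := fun i => mem_closedBall_self hε
  have hclose : ∀ k, ∀ i ≤ n, P k i ∈ closedBall (q i) ε := by
    intro k
    induction k with
    | zero =>
      intro i hi
      rcases hcases i hi with rfl | rfl | ⟨j, rfl, hj⟩
      · rwa [hPz]
      · rwa [hPn 0 i le_rfl]
      · rw [hP0, if_neg (by omega), if_pos (by omega)]
        exact hqself _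
    | succ k ih =>
      intro i hi
      rcases hcases i hi with rfl | rfl | ⟨j, rfl, hj⟩
      · rwa [hPz]
      · rwa [hPn _ i le_rfl]
      · rw [hPint k j hj, mem_closedBall, hq j hj]
        have h1 := ih j (by omega)
        have h2 := ih (j + 2) hj
        have := hM j hj _ h1 _ h2 _ (hqself _) _ (hqself _)
        rw [mem_closedBall] at h1 h2
        linarith
  have hn' : (0 : ℝ) < n := by exact_mod_cast hn
  have hn1 : (1 : ℝ) ≤ n := by exact_mod_cast hn
  set θ : ℝ := 1 - 1 / (n : ℝ) ^ 2 with hθ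
  have hθ0 : 0 ≤ θ := by
    rw [hθ, sub_nonneg, div_le_one (by positivity)]
    nlinarith
  have hθ1 : θ < 1 := by
    rw [hθ]
    have : 0 < 1 / (n : ℝ) ^ 2 := by positivity
    linarith
  have hstep : ∀ k, ∀ i ≤ n, dist (P (k + 1) i) (P k i) ≤ 2 * ε * θ ^ k * (i * (n - i)) := by
    have hbd : ∀ k i, i = 0 ∨ n = i →
        dist (P (k + 1) i) (P k i) ≤ 2 * ε * θ ^ k * (i * (n - i)) := by
      rintro k i (rfl | rfl)
      · simp [hPz]
      · simp [hPn _ n le_rfl]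
    intro k
    induction k with
    | zero =>
      intro i hi
      rcases hcases i hi with h | h | ⟨j, rfl, hj⟩
      · exact hbd 0 i (Or.inl h)
      · exact hbd 0 i (Or.inr h.symm)
      · have h1 := hclose 1 (j + 1) hi
        have h2 := hclose 0 (j + 1) hi
        rw [mem_closedBall] at h1 h2
        have h3 := dist_triangle_right (P 1 (j + 1)) (P 0 (j + 1)) (q (j + 1))
        have hj' : (j : ℝ) + 2 ≤ n := by exact_mod_cast hj
        have h4 : (1 : ℝ) ≤ ((j + 1 : ℕ) : ℝ) * (n - ((j + 1 : ℕ) : ℝ)) := by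
          push_cast
          have : (0 : ℝ) ≤ j := j.cast_nonneg
          nlinarith
        have h5 := mul_le_mul_of_nonneg_left h4 (show 0 ≤ 2 * ε by positivity)
        rw [pow_zero, mul_one]
        simp only [zero_add] at h3 ⊢
        linarith
    | succ k ih =>
      intro i hi
      rcases hcases i hi with h | h | ⟨j, rfl, hj⟩
      · exact hbd _ i (Or.inl h)
      · exact hbd _ i (Or.inr h.symm)
      · rw [hPint _ j hj, hPint _ j hj]
        have h1 := hM j hj _ (hclose (k + 1) j (by omega)) _ (hclose (k + 1) (j + 2) hj) _
          (hclose k j (by omega)) _ (hclose k (j + 2) hj)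
        have h2 := ih j (by omega)
        have h3 := ih (j + 2) hj
        have hj' : (j : ℝ) + 2 ≤ n := by exact_mod_cast hj
        have hj0 : (0 : ℝ) ≤ j := j.cast_nonneg
        have h4 : ((j + 1 : ℝ) * (n - (j + 1))) - 1 ≤ θ * ((j + 1) * (n - (j + 1))) := by
          have h5 : (j + 1 : ℝ) * (n - (j + 1)) ≤ n ^ 2 := by nlinarith
          have h6 : 1 / (n : ℝ) ^ 2 * ((j + 1) * (n - (j + 1))) ≤ 1 := by
            rw [one_div_mul_eq_div, div_le_one (by positivity)]
            exact h5
          rw [hθ]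
          linarith
        have h5 := mul_le_mul_of_nonneg_left h4 (show 0 ≤ 2 * ε * θ ^ k by positivity)
        push_cast at h2 h3 ⊢
        rw [pow_succ]
        nlinarith
  have hlim : ∀ i, ∃ l, Filter.Tendsto (fun k => P k i) Filter.atTop (nhds l) := by
    intro i
    rcases le_total n i with h | h
    · exact ⟨y, by simp [hPn _ i h]⟩
    · refine cauchySeq_tendsto_of_complete (cauchySeq_of_le_geometric θ (2 * ε * (i * (n - i))) hθ1
        fun k => ?_)
      rw [dist_comm]
      refine (hstep k i h).trans (le_of_eq (by ring))
  choose p hp using hlim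
  have hpclose : ∀ i ≤ n, p i ∈ closedBall (q i) ε := fun i hi =>
    isClosed_closedBall.mem_of_tendsto (hp i) (Filter.Eventually.of_forall fun k => hclose k i hi)
  refine ⟨p, tendsto_nhds_unique (hp 0) (by simp [hPz]), fun i hi =>
    tendsto_nhds_unique (hp i) (by simp [hPn _ i hi]), hpclose, fun i hi => ?_⟩
  refine tendsto_nhds_unique ((hp (i + 1)).comp (Filter.tendsto_add_atTop_nat 1)) ?_
  rw [tendsto_iff_dist_tendsto_zero]
  have h0 := ((tendsto_iff_dist_tendsto_zero.1 (hp i)).add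
    (tendsto_iff_dist_tendsto_zero.1 (hp (i + 2)))).div_const 2
  simp only [add_zero, zero_div] at h0
  refine squeeze_zero (fun _ => dist_nonneg) (fun k => ?_) h0
  rw [Function.comp_apply, hPint k i hi]
  exact hM i hi _ (hclose k i (by omega)) _ (hclose k _ hi) _ (hpclose i (by omega)) _
    (hpclose _ hi)

namespace LocalGeodesicBicombing

variable {X : Type*} [MetricSpace X] {L : LocalGeodesicBicombing X}

/-- A chain of points in which each point is the midpoint of its neighbours can be interpolated
by a locally consistent curve. -/
theorem exists_isLocallyConsistent_of_chain {n : ℕ} (hn : 2 ≤ n) {p : ℕ → X}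
    (hend : p (n + 1) = p n) (hdom : ∀ i, i + 2 ≤ n → L.InDom (p i) (p (i + 2)))
    (hmid : ∀ i, i + 2 ≤ n → p (i + 1) = L.σ (p i) (p (i + 2)) (1 / 2)) :
    ∃ c, L.IsLocallyConsistent c ∧ c 0 = p 0 ∧ c 1 = p n ∧
      ∀ i < n, ∀ s ∈ Icc (0 : ℝ) 1, c ((i + s) / n) = L.σ (p i) (p (i + 1)) s := by
  have hn0 : (0 : ℝ) < n := by positivity
  have hh : (1 / 2 : ℝ) ∈ Icc (0 : ℝ) 1 := by constructor <;> norm_num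
  have hdom1 : ∀ i ≤ n, L.InDom (p i) (p (i + 1)) := by
    intro i hi
    rcases hi.eq_or_lt with rfl | hi
    · rw [hend]
      exact InDom.refl L _
    rcases Nat.lt_or_ge n (i + 2) with h | h
    · obtain ⟨j, rfl⟩ : ∃ j, i = j + 1 := ⟨i - 1, by omega⟩
      have hj : j + 2 ≤ n := by omega
      obtain ⟨x, h1, h2⟩ := hdom j hj
      exact ⟨x, hmid j hj ▸ L.mem_ball x _ _ h1 h2 _ hh, h2⟩
    · obtain ⟨x, h1, h2⟩ := hdom i h
      exact ⟨x, h1, hmid i h ▸ L.mem_ball x _ _ h1 h2 _ hh⟩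
  let c : ℝ → X := fun t => L.σ (p ⌊n * t⌋₊) (p (⌊n * t⌋₊ + 1)) (n * t - ⌊n * t⌋₊)
  have hc : ∀ (i : ℕ) (s : ℝ), 0 ≤ s → s < 1 → c ((i + s) / n) = L.σ (p i) (p (i + 1)) s := by
    intro i s hs0 hs1
    have e : (n : ℝ) * ((i + s) / n) = i + s := by field_simp
    have hf : ⌊(i + s : ℝ)⌋₊ = i := by
      rw [Nat.floor_eq_iff (by positivity)]
      constructor <;> linarith
    simp only [c]
    rw [e, hf, add_sub_cancel_left]
  have hnode : ∀ i ≤ n, c (i / n) = p i := by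
    intro i hi
    have := hc i 0 le_rfl one_pos
    rw [add_zero, (hdom1 i hi).source] at this
    exact this
  have hc1 : ∀ i < n, ∀ s ∈ Icc (0 : ℝ) 1, c ((i + s) / n) = L.σ (p i) (p (i + 1)) s := by
    intro i hi s hs
    rcases hs.2.eq_or_lt with rfl | h
    · rw [(hdom1 i hi.le).target, ← hnode (i + 1) hi]
      push_cast
      rfl
    · exact hc i s hs.1 h
  have hc2 : ∀ i, i + 2 ≤ n → ∀ s ∈ Icc (0 : ℝ) 1,
      c ((i + 2 * s) / n) = L.σ (p i) (p (i + 2)) s := by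
    intro i hi s hs
    obtain ⟨x, h1, h2⟩ := hdom i hi
    rcases le_total s (1 / 2) with h | h
    · have hs' : 2 * s ∈ Icc (0 : ℝ) 1 := ⟨by linarith [hs.1], by linarith⟩
      rw [hc1 i (by omega) (2 * s) hs', hmid i hi]
      have := L.consistent x _ _ h1 h2 0 (1 / 2) le_rfl (by norm_num) (by norm_num) _ hs'
      rw [L.source x _ _ h1 h2] at this
      rw [this]
      congr 1
      ring
    · have hs' : 2 * s - 1 ∈ Icc (0 : ℝ) 1 := ⟨by linarith, by linarith [hs.2]⟩
      have e := hc1 (i + 1) (by omega) (2 * s - 1) hs'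
      rw [show (((i + 1 : ℕ) : ℝ) + (2 * s - 1)) = i + 2 * s by push_cast; ring, hmid i hi] at e
      rw [e]
      have := L.consistent x _ _ h1 h2 (1 / 2) 1 (by norm_num) (by norm_num) le_rfl _ hs'
      rw [L.target x _ _ h1 h2] at this
      rw [show i + 1 + 1 = i + 2 by ring, this]
      congr 1
      ring
  refine ⟨c, fun t ht => ?_, by simpa using hnode 0 (Nat.zero_le n), by
    simpa [hn0.ne'] using hnode n le_rfl, hc1⟩
  obtain ⟨i, hi, hlo, hup⟩ : ∃ i : ℕ, i + 2 ≤ n ∧ ((i : ℝ) = 0 ∨ (i : ℝ) ≤ n * t - 1 / 2) ∧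
      ((i : ℝ) + 2 = n ∨ n * t + 1 / 2 ≤ i + 2) := by
    have h2 : (n : ℝ) * t - 1 / 2 < ⌊(n : ℝ) * t - 1 / 2⌋₊ + 1 := Nat.lt_floor_add_one _
    have h1 : ⌊(n : ℝ) * t - 1 / 2⌋₊ = 0 ∨ (⌊(n : ℝ) * t - 1 / 2⌋₊ : ℝ) ≤ n * t - 1 / 2 := by
      rcases le_total 0 ((n : ℝ) * t - 1 / 2) with h | h
      · exact Or.inr (Nat.floor_le h)
      · exact Or.inl (Nat.floor_eq_zero.2 (by linarith))
    rcases Nat.lt_or_ge n (⌊(n : ℝ) * t - 1 / 2⌋₊ + 2) with h | h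
    · have h' : (n : ℝ) + 1 ≤ ⌊(n : ℝ) * t - 1 / 2⌋₊ + 2 := by exact_mod_cast h
      have e : ((n - 2 : ℕ) : ℝ) = n - 2 := by push_cast [hn]; ring
      refine ⟨n - 2, by omega, ?_, Or.inl (by rw [e]; ring)⟩
      rcases h1 with h1 | h1
      · exact Or.inl (by exact_mod_cast (show n - 2 = 0 by omega))
      · exact Or.inr (by rw [e]; linarith)
    · refine ⟨_, h, h1.imp_left (by exact_mod_cast ·), Or.inr (by linarith)⟩
  have hparam : ∀ a ∈ Icc (0 : ℝ) 1 ∩ Ioo (t - 1 / (2 * n)) (t + 1 / (2 * n)),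
      ∃ α ∈ Icc (0 : ℝ) 1, a = (i + 2 * α) / n := by
    intro a ha
    have e : (n : ℝ) * (1 / (2 * n)) = 1 / 2 := by field_simp
    have h1 : (n : ℝ) * t - 1 / 2 < n * a := by
      have := mul_lt_mul_of_pos_left ha.2.1 hn0
      linarith
    have h2 : (n : ℝ) * a < n * t + 1 / 2 := by
      have := mul_lt_mul_of_pos_left ha.2.2 hn0
      linarith
    have h3 : 0 ≤ (n : ℝ) * a := mul_nonneg hn0.le ha.1.1
    have h4 : (n : ℝ) * a ≤ n := mul_le_of_le_one_right hn0.le ha.1.2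
    refine ⟨(n * a - i) / 2, ⟨?_, ?_⟩, by field_simp; ring⟩
    · rcases hlo with h | h <;> linarith
    · rcases hup with h | h <;> linarith
  refine ⟨1 / (2 * n), by positivity, fun a ha b hb hab => ?_⟩
  obtain ⟨α, hα, rfl⟩ := hparam a ha
  obtain ⟨β, hβ, rfl⟩ := hparam b hb
  obtain ⟨x, h1, h2⟩ := hdom i hi
  have hαβ : α ≤ β := by
    have := (div_le_div_iff_of_pos_right hn0).1 hab
    linarith
  rw [hc2 i hi α hα, hc2 i hi β hβ]
  refine ⟨⟨x, L.mem_ball x _ _ h1 h2 _ hα, L.mem_ball x _ _ h1 h2 _ hβ⟩, fun s hs => ?_⟩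
  rw [L.consistent x _ _ h1 h2 α β hα.1 hαβ hβ.2 s hs,
    ← hc2 i hi _ (affine_mem_Icc hα hβ hs)]
  congr 1
  ring

/-- Locally consistent curves can be perturbed so as to have any endpoints near the given ones. -/
theorem IsLocallyConsistent.exists_perturbation [CompleteSpace X] (hL : L.IsConvex) {c : ℝ → X}
    (hc : L.IsLocallyConsistent c) : ∃ ε > 0, ∀ x ∈ ball (c 0) ε, ∀ y ∈ ball (c 1) ε,
      ∃ c', L.IsLocallyConsistent c' ∧ c' 0 = x ∧ c' 1 = y ∧
        ∀ t ∈ Icc (0 : ℝ) 1, L.InDom (c t) (c' t) := by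
  obtain ⟨ρ, hρ, hball⟩ := hc.exists_ball_subset
  obtain ⟨δ, hδ, hcont⟩ := hc.exists_dist_lt (half_pos hρ)
  obtain ⟨m, hm⟩ := exists_nat_one_div_lt hδ
  set n := m + 2 with hn_def
  have hn0 : (0 : ℝ) < n := by positivity
  have hnδ : 1 / (n : ℝ) < δ := by
    refine lt_of_le_of_lt (one_div_le_one_div_of_le (by positivity) ?_) hm
    rw [hn_def]
    push_cast
    linarith
  have hI : ∀ i ≤ n, (i / n : ℝ) ∈ Icc (0 : ℝ) 1 := fun i hi =>
    ⟨by positivity, (div_le_one hn0).2 (by exact_mod_cast hi)⟩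
  have hnear : ∀ i ≤ n, ∀ u ∈ Icc (0 : ℝ) 1, |n * u - i| ≤ 1 →
      dist (c u) (c (i / n)) < ρ / 2 := by
    intro i hi u hu h
    refine hcont _ hu _ (hI i hi) (lt_of_le_of_lt ?_ hnδ)
    have e : u - i / n = (n * u - i) / n := by field_simp
    rw [e, abs_div, abs_of_pos hn0]
    gcongr
  have hnode : ∀ i j : ℕ, i ≤ n → j ≤ n → |(j : ℝ) - i| ≤ 1 →
      closedBall (c (j / n)) (ρ / 2) ⊆ ball (c (i / n)) ρ := by
    intro i j hi hj hij y hy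
    have h1 := hnear i hi _ (hI j hj) (by
      rwa [show (n : ℝ) * (j / n) = j by field_simp])
    rw [mem_closedBall] at hy
    rw [Metric.mem_ball]
    linarith [dist_triangle y (c (j / n)) (c (i / n))]
  have hcast : ∀ i : ℕ, |(i : ℝ) - ((i + 1 : ℕ) : ℝ)| ≤ 1 ∧
      |((i + 2 : ℕ) : ℝ) - ((i + 1 : ℕ) : ℝ)| ≤ 1 ∧ |((i + 1 : ℕ) : ℝ) - i| ≤ 1 := by
    intro i
    push_cast
    refine ⟨?_, ?_, ?_⟩ <;> rw [abs_le] <;> constructor <;> linarith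
  have hh : (1 / 2 : ℝ) ∈ Icc (0 : ℝ) 1 := by constructor <;> norm_num
  refine ⟨ρ / 2, half_pos hρ, fun x hx y hy => ?_⟩
  obtain ⟨p, hp0, hpn, hpq, hpmid⟩ := exists_midpoint_chain (n := n)
    (q := fun i => c (i / n)) (M := fun y z => L.σ y z (1 / 2)) (ε := ρ / 2) (x := x) (y := y)
    (by
      intro i hi y hy z hz y' hy' z' hz'
      obtain ⟨w, hw⟩ := hball _ (hI (i + 1) (by omega))
      have s1 := (hnode (i + 1) i (by omega) (by omega) (hcast i).1).trans hw
      have s2 := (hnode (i + 1) (i + 2) (by omega) hi (hcast i).2.1).trans hw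
      have := dist_sigma_le hL (s1 hy) (s2 hz) (s1 hy') (s2 hz') hh
      linarith)
    (by
      intro i hi
      obtain ⟨w, hw⟩ := hball _ (hI (i + 1) (by omega))
      have hab : (i / n : ℝ) ≤ ((i + 2 : ℕ) : ℝ) / n := by
        gcongr
        omega
      have := hc.eq_sigma_of_mem_ball hL (hI i (by omega)).1 hab (hI (i + 2) hi).2 (x := w) (by
        intro u hu
        refine hw (lt_trans (hnear (i + 1) (by omega) u ⟨(hI i (by omega)).1.trans hu.1,
          hu.2.trans (hI (i + 2) hi).2⟩ ?_) (half_lt_self hρ))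
        have h1 := (div_le_iff₀' hn0).1 hu.1
        have h2 := (le_div_iff₀' hn0).1 hu.2
        push_cast at h2 ⊢
        rw [abs_le]
        constructor <;> linarith) hh
      refine Eq.trans ?_ this
      congr 1
      push_cast
      field_simp
      ring)
    (by omega) (by simpa using ball_subset_closedBall hx)
    (by simpa [hn0.ne'] using ball_subset_closedBall hy)
  obtain ⟨c', hc', h0, h1, hseg⟩ := exists_isLocallyConsistent_of_chain (L := L) (n := n)
    (by omega) (p := p) (by rw [hpn n le_rfl, hpn (n + 1) (by omega)]) (by
      intro i hi
      obtain ⟨w, hw⟩ := hball _ (hI (i + 1) (by omega))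
      exact ⟨w, hw (hnode (i + 1) i (by omega) (by omega) (hcast i).1 (hpq i (by omega))),
        hw (hnode (i + 1) (i + 2) (by omega) hi (hcast i).2.1 (hpq _ hi))⟩) hpmid
  refine ⟨c', hc', h0.trans hp0, h1.trans (hpn n le_rfl), fun t ht => ?_⟩
  obtain ⟨i, hi, s, hs, rfl⟩ : ∃ i < n, ∃ s ∈ Icc (0 : ℝ) 1, t = (i + s) / n := by
    rcases ht.2.eq_or_lt with rfl | ht1
    · refine ⟨n - 1, by omega, 1, by simp, ?_⟩
      rw [Nat.cast_sub (by omega)]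
      field_simp
      simp
    · have h0 : 0 ≤ (n : ℝ) * t := mul_nonneg hn0.le ht.1
      refine ⟨⌊(n : ℝ) * t⌋₊, (Nat.floor_lt h0).2 (by nlinarith), n * t - ⌊(n : ℝ) * t⌋₊,
        ⟨sub_nonneg.2 (Nat.floor_le h0), by linarith [Nat.lt_floor_add_one ((n : ℝ) * t)]⟩, ?_⟩
      field_simp
      ring
  obtain ⟨w, hw⟩ := hball _ (hI i hi.le)
  rw [hseg i hi s hs]
  refine ⟨w, hw (lt_trans (hnear i hi.le _ ht ?_) (half_lt_self hρ)),
    L.mem_ball w _ _ (hw (hnode i i hi.le hi.le (by simp) (hpq i hi.le)))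
      (hw (hnode i (i + 1) hi.le hi (hcast i).2.2 (hpq _ hi))) s hs⟩
  rw [show (n : ℝ) * ((i + s) / n) - i = s by field_simp; ring, abs_of_nonneg hs.1]
  exact hs.2

end LocalGeodesicBicombing

/-- A map is a local isometry if every point has a ball mapped isometrically onto the ball of the
same radius around its image. -/
def IsLocalIsometry {E X : Type*} [MetricSpace E] [MetricSpace X] (p : E → X) : Prop :=
  ∀ e, ∃ ε > 0, (∀ e' ∈ ball e ε, ∀ e'' ∈ ball e ε, dist (p e') (p e'') = dist e' e'') ∧
    ∀ z ∈ ball (p e) ε, ∃ e' ∈ ball e ε, p e' = z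

namespace IsLocalIsometry

variable {E X : Type*} [MetricSpace E] [MetricSpace X] {p : E → X}

lemma isLocalHomeomorph (hp : IsLocalIsometry p) : IsLocalHomeomorph p := by
  rw [isLocalHomeomorph_iff_isOpenEmbedding_restrict]
  intro e
  obtain ⟨ε, hε, hiso, hsurj⟩ := hp e
  refine ⟨ball e ε, ball_mem_nhds e hε, ?_⟩
  have h1 : Isometry ((ball e ε).domRestrict p) :=
    Isometry.of_dist_eq fun a b => hiso a a.2 b b.2
  refine ⟨h1.isEmbedding, ?_⟩
  have h2 : range ((ball e ε).domRestrict p) = ball (p e) ε := by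
    ext z
    constructor
    · rintro ⟨a, rfl⟩
      have := hiso a a.2 e (mem_ball_self hε)
      rw [domRestrict_apply, Metric.mem_ball, this]
      exact a.2
    · intro hz
      obtain ⟨e', he', rfl⟩ := hsurj z hz
      exact ⟨⟨e', he'⟩, rfl⟩
  rw [h2]
  exact isOpen_ball

lemma eqOn_of_comp_eqOn (hp : IsLocalIsometry p) {Γ Γ' : ℝ → E} {b : ℝ} (hb : 0 ≤ b)
    (h : ContinuousOn Γ (Icc 0 b)) (h' : ContinuousOn Γ' (Icc 0 b))
    (hpp : ∀ s ∈ Icc 0 b, p (Γ s) = p (Γ' s)) (h0 : Γ 0 = Γ' 0) : EqOn Γ Γ' (Icc 0 b) :=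
  (T2Space.isSeparatedMap p).eqOn_of_comp_eqOn hp.isLocalHomeomorph.isLocallyInjective
    isPreconnected_Icc h h' hpp ⟨le_rfl, hb⟩ h0

/-- Extension of a Lipschitz lift over a closed interval to a slightly larger one. -/
lemma exists_lipschitz_extension (hp : IsLocalIsometry p) {γ : ℝ → X} {K b : ℝ} (hK : 0 ≤ K)
    (hb : b ∈ Ico (0:ℝ) 1)
    (hγ : ∀ s ∈ Icc (0:ℝ) 1, ∀ t ∈ Icc (0:ℝ) 1, dist (γ s) (γ t) ≤ K * |s - t|) {Γ : ℝ → E}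
    (hΓ : ∀ s ∈ Icc 0 b, ∀ t ∈ Icc 0 b, dist (Γ s) (Γ t) ≤ K * |s - t|)
    (hpΓ : ∀ s ∈ Icc 0 b, p (Γ s) = γ s) :
    ∃ b' ∈ Ioc b 1, ∃ Γ' : ℝ → E, (∀ s ∈ Icc 0 b', ∀ t ∈ Icc 0 b',
      dist (Γ' s) (Γ' t) ≤ K * |s - t|) ∧ (∀ s ∈ Icc 0 b', p (Γ' s) = γ s) ∧ Γ' 0 = Γ 0 := by
  obtain ⟨ε, hε, hiso, hsurj⟩ := hp (Γ b)
  have hbb : b ∈ Icc 0 b := ⟨hb.1, le_rfl⟩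
  obtain ⟨δ, hδ, hδε⟩ : ∃ δ > 0, K * δ < ε :=
    ⟨ε / (K + 1), by positivity, by
      rw [mul_div_assoc', div_lt_iff₀ (by positivity)]; nlinarith⟩
  set b' := min 1 (b + δ) with hb'
  have hb1 : b' ≤ 1 := min_le_left _ _
  have hbδ : b' ≤ b + δ := min_le_right _ _
  have hlt : b < b' := lt_min hb.2 (by linarith)
  have key : ∀ t, ∃ e', t ∈ Icc b b' → e' ∈ ball (Γ b) ε ∧ p e' = γ t := by
    intro t
    by_cases ht : t ∈ Icc b b'
    · have hz : γ t ∈ ball (p (Γ b)) ε := by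
        rw [hpΓ b hbb, Metric.mem_ball]
        refine (hγ t ⟨hb.1.trans ht.1, ht.2.trans hb1⟩ b ⟨hb.1, hb.2.le⟩).trans_lt ?_
        rw [abs_of_nonneg (by linarith [ht.1])]
        exact (mul_le_mul_of_nonneg_left (by linarith [ht.2]) hK).trans_lt hδε
      obtain ⟨e', h1, h2⟩ := hsurj _ hz
      exact ⟨e', fun _ => ⟨h1, h2⟩⟩
    · exact ⟨Γ b, fun h => absurd h ht⟩
  choose g hg using key
  have hgb : g b = Γ b := by
    have h1 := hg b ⟨le_rfl, hlt.le⟩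
    have h2 := hiso _ h1.1 _ (mem_ball_self hε)
    rw [h1.2, hpΓ b hbb, dist_self] at h2
    exact dist_eq_zero.1 h2.symm
  have hgl : ∀ s ∈ Icc b b', ∀ t ∈ Icc b b', dist (g s) (g t) ≤ K * |s - t| := by
    intro s hs t ht
    rw [← hiso _ (hg s hs).1 _ (hg t ht).1, (hg s hs).2, (hg t ht).2]
    exact hγ s ⟨hb.1.trans hs.1, hs.2.trans hb1⟩ t ⟨hb.1.trans ht.1, ht.2.trans hb1⟩
  have mixed : ∀ s ∈ Icc 0 b, ∀ t ∈ Icc b b', dist (Γ s) (g t) ≤ K * |s - t| := by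
    intro s hs t ht
    have h1 := hΓ s hs b hbb
    have h2 := hgl b ⟨le_rfl, hlt.le⟩ t ht
    rw [abs_of_nonpos (by linarith [hs.2])] at h1
    rw [abs_of_nonpos (by linarith [ht.1]), hgb] at h2
    rw [abs_of_nonpos (by linarith [hs.2, ht.1])]
    linarith [dist_triangle (Γ s) (Γ b) (g t)]
  refine ⟨b', ⟨hlt, hb1⟩, fun s => if s ≤ b then Γ s else g s, ?_, ?_, if_pos hb.1⟩
  · intro s hs t ht
    dsimp only
    split_ifs with h1 h2 h2
    · exact hΓ s ⟨hs.1, h1⟩ t ⟨ht.1, h2⟩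
    · exact mixed s ⟨hs.1, h1⟩ t ⟨(not_le.1 h2).le, ht.2⟩
    · rw [dist_comm, abs_sub_comm]
      exact mixed t ⟨ht.1, h2⟩ s ⟨(not_le.1 h1).le, hs.2⟩
    · exact hgl s ⟨(not_le.1 h1).le, hs.2⟩ t ⟨(not_le.1 h2).le, ht.2⟩
  · intro s hs
    dsimp only
    split_ifs with h1
    · exact hpΓ s ⟨hs.1, h1⟩
    · exact (hg s ⟨(not_le.1 h1).le, hs.2⟩).2

lemma continuousOn_of_dist_le {γ : ℝ → E} {K : ℝ} {s : Set ℝ}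
    (h : ∀ u ∈ s, ∀ v ∈ s, dist (γ u) (γ v) ≤ K * |u - v|) : ContinuousOn γ s :=
  (LipschitzOnWith.of_dist_le_mul (K := K.toNNReal) fun u hu v hv =>
    (h u hu v hv).trans
      (mul_le_mul_of_nonneg_right (Real.le_coe_toNNReal K) (abs_nonneg _))).continuousOn

/-- Lipschitz paths lift through local isometries with complete source. -/
lemma exists_lipschitz_lift [CompleteSpace E] (hp : IsLocalIsometry p) {γ : ℝ → X} {K : ℝ}
    (hK : 0 ≤ K)
    (hγ : ∀ s ∈ Icc (0:ℝ) 1, ∀ t ∈ Icc (0:ℝ) 1, dist (γ s) (γ t) ≤ K * |s - t|) {e : E}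
    (he : p e = γ 0) :
    ∃ Γ : ℝ → E, (∀ s ∈ Icc (0:ℝ) 1, ∀ t ∈ Icc (0:ℝ) 1, dist (Γ s) (Γ t) ≤ K * |s - t|) ∧
      (∀ s ∈ Icc (0:ℝ) 1, p (Γ s) = γ s) ∧ Γ 0 = e := by
  set S : Set ℝ := {b | b ∈ Icc (0:ℝ) 1 ∧ ∃ Γ : ℝ → E,
    (∀ s ∈ Icc 0 b, ∀ t ∈ Icc 0 b, dist (Γ s) (Γ t) ≤ K * |s - t|) ∧
      (∀ s ∈ Icc 0 b, p (Γ s) = γ s) ∧ Γ 0 = e} with hS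
  have h0 : (0:ℝ) ∈ S := by
    refine ⟨⟨le_rfl, zero_le_one⟩, fun _ => e, fun s _ t _ => ?_, fun s hs => ?_, rfl⟩
    · rw [dist_self]; positivity
    · rw [he, le_antisymm hs.2 hs.1]
  have hbdd : BddAbove S := ⟨1, fun b hb => hb.1.2⟩
  set b := sSup S with hbdef
  have hb0 : 0 ≤ b := le_csSup hbdd h0
  have hb1 : b ≤ 1 := csSup_le ⟨0, h0⟩ fun b hb => hb.1.2
  have hbS : b ∈ S := by
    rcases hb0.eq_or_lt with hb | hb
    · rw [← hb]; exact h0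
    have hdown : ∀ s, ∃ Γ : ℝ → E, s ∈ Ico 0 b →
        (∀ u ∈ Icc 0 s, ∀ v ∈ Icc 0 s, dist (Γ u) (Γ v) ≤ K * |u - v|) ∧
          (∀ u ∈ Icc 0 s, p (Γ u) = γ u) ∧ Γ 0 = e := by
      intro s
      by_cases hs : s ∈ Ico 0 b
      · obtain ⟨t, ht, hst⟩ := exists_lt_of_lt_csSup ⟨0, h0⟩ hs.2
        obtain ⟨-, Γ, h1, h2, h3⟩ := ht
        exact ⟨Γ, fun _ => ⟨fun u hu v hv => h1 u ⟨hu.1, hu.2.trans hst.le⟩ v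
          ⟨hv.1, hv.2.trans hst.le⟩, fun u hu => h2 u ⟨hu.1, hu.2.trans hst.le⟩, h3⟩⟩
      · exact ⟨fun _ => e, fun h => absurd h hs⟩
    choose G hG using hdown
    have agree : ∀ s ∈ Ico 0 b, ∀ t ∈ Ico 0 b, s ≤ t → G t s = G s s := by
      intro s hs t ht hst
      obtain ⟨a1, a2, a3⟩ := hG s hs
      obtain ⟨b1, b2, b3⟩ := hG t ht
      refine hp.eqOn_of_comp_eqOn hs.1 ((continuousOn_of_dist_le b1).mono
        (Icc_subset_Icc_right hst)) (continuousOn_of_dist_le a1) (fun u hu => ?_)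
        (b3.trans a3.symm) ⟨hs.1, le_rfl⟩
      rw [a2 u hu, b2 u ⟨hu.1, hu.2.trans hst⟩]
    have lip' : ∀ s ∈ Ico 0 b, ∀ t ∈ Ico 0 b, s ≤ t → dist (G s s) (G t t) ≤ K * |s - t| := by
      intro s hs t ht hst
      rw [← agree s hs t ht hst]
      exact (hG t ht).1 s ⟨hs.1, hst⟩ t ⟨ht.1, le_rfl⟩
    have lip : ∀ s ∈ Ico 0 b, ∀ t ∈ Ico 0 b, dist (G s s) (G t t) ≤ K * |s - t| := by
      intro s hs t ht
      rcases le_total s t with h | h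
      · exact lip' s hs t ht h
      · rw [dist_comm, abs_sub_comm]; exact lip' t ht s hs h
    obtain ⟨u, -, hub, hulim⟩ := exists_seq_strictMono_tendsto' hb
    have hu : ∀ n, u n ∈ Ico 0 b := fun n => ⟨(hub n).1.le, (hub n).2⟩
    have hcau : CauchySeq fun n => G (u n) (u n) := by
      rw [Metric.cauchySeq_iff]
      intro η hη
      obtain ⟨N, hN⟩ := Metric.cauchySeq_iff.1 hulim.cauchySeq (η / (K + 1)) (by positivity)
      refine ⟨N, fun m hm n hn => (lip _ (hu m) _ (hu n)).trans_lt ?_⟩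
      have h1 := hN m hm n hn
      rw [Real.dist_eq, lt_div_iff₀ (by positivity)] at h1
      nlinarith [abs_nonneg (u m - u n)]
    obtain ⟨e₁, he₁⟩ := cauchySeq_tendsto_of_complete hcau
    have lip₁ : ∀ s ∈ Ico 0 b, dist (G s s) e₁ ≤ K * |s - b| := by
      intro s hs
      have h1 : Filter.Tendsto (fun n => dist (G s s) (G (u n) (u n))) Filter.atTop
          (nhds (dist (G s s) e₁)) := tendsto_const_nhds.dist he₁
      have h2 : Filter.Tendsto (fun n => K * |s - u n|) Filter.atTop (nhds (K * |s - b|)) :=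
        ((tendsto_const_nhds.sub hulim).abs).const_mul K
      exact le_of_tendsto_of_tendsto' h1 h2 fun n => lip s hs _ (hu n)
    have hpe₁ : p e₁ = γ b := by
      have h1 : Filter.Tendsto (fun n => p (G (u n) (u n))) Filter.atTop (nhds (p e₁)) :=
        (hp.isLocalHomeomorph.continuous.tendsto e₁).comp he₁
      have h2 : Filter.Tendsto (fun n => γ (u n)) Filter.atTop (nhds (γ b)) := by
        have h3 := continuousOn_of_dist_le hγ b ⟨hb0, hb1⟩
        refine h3.tendsto.comp (tendsto_nhdsWithin_iff.2 ⟨hulim, Filter.Eventually.of_forall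
          fun n => ⟨(hu n).1, (hu n).2.le.trans hb1⟩⟩)
      refine tendsto_nhds_unique h1 (h2.congr fun n => ?_)
      exact ((hG _ (hu n)).2.1 _ ⟨(hu n).1, le_rfl⟩).symm
    refine ⟨⟨hb0, hb1⟩, fun s => if s < b then G s s else e₁, ?_, ?_, ?_⟩
    · intro s hs t ht
      dsimp only
      split_ifs with h1 h2 h2
      · exact lip s ⟨hs.1, h1⟩ t ⟨ht.1, h2⟩
      · rw [le_antisymm ht.2 (not_lt.1 h2)]; exact lip₁ s ⟨hs.1, h1⟩
      · rw [le_antisymm hs.2 (not_lt.1 h1), dist_comm, abs_sub_comm]; exact lip₁ t ⟨ht.1, h2⟩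
      · rw [dist_self]; positivity
    · intro s hs
      dsimp only
      split_ifs with h1
      · exact (hG s ⟨hs.1, h1⟩).2.1 s ⟨hs.1, le_rfl⟩
      · rw [hpe₁, le_antisymm hs.2 (not_lt.1 h1)]
    · dsimp only
      rw [if_pos hb]
      exact (hG 0 ⟨le_rfl, hb⟩).2.2
  rcases hb1.eq_or_lt with h | h
  · obtain ⟨-, Γ, hΓ⟩ := hbS
    rw [h] at hΓ
    exact ⟨Γ, hΓ⟩
  · obtain ⟨-, Γ, h1, h2, h3⟩ := hbS
    obtain ⟨b', hb', Γ', g1, g2, g3⟩ := hp.exists_lipschitz_extension hK ⟨hb0, h⟩ hγ h1 h2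
    have : b' ≤ b := le_csSup hbdd ⟨⟨hb0.trans hb'.1.le, hb'.2⟩, Γ', g1, g2, g3.trans h3⟩
    exact absurd hb'.1 (not_lt.2 this)

open unitInterval in
/-- Balls of a local geodesic bicombing carry continuous sections through any given point. -/
lemma exists_section [CompleteSpace E] (hp : IsLocalIsometry p) {L : LocalGeodesicBicombing X}
    (hL : L.IsConvex) {y : X} {e : E} (he : p e ∈ ball y (L.r y)) :
    ∃ q : X → E, ContinuousOn q (ball y (L.r y)) ∧ (∀ z ∈ ball y (L.r y), p (q z) = z) ∧
      q (p e) = e := by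
  have hlift : ∀ z : ball y (L.r y), ∃ Γ : ℝ → E,
      (∀ s ∈ Icc (0:ℝ) 1, ∀ t ∈ Icc (0:ℝ) 1,
        dist (Γ s) (Γ t) ≤ dist (p e) z.1 * |s - t|) ∧
      (∀ s ∈ Icc (0:ℝ) 1, p (Γ s) = L.σ (p e) z.1 s) ∧ Γ 0 = e := by
    intro z
    refine hp.exists_lipschitz_lift dist_nonneg (fun s hs t ht => ?_) (L.source y _ _ he z.2).symm
    rw [L.geodesic y _ _ he z.2 s hs t ht, mul_comm]
  choose Γ hΓ1 hΓ2 hΓ3 using hlift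
  have hf : Continuous fun x : I × ball y (L.r y) => L.σ (p e) x.2.1 x.1.1 := by
    rw [continuous_iff_continuousAt]
    rintro ⟨s, z⟩
    rw [ContinuousAt, tendsto_iff_dist_tendsto_zero]
    have hb : ∀ x : I × ball y (L.r y), dist (L.σ (p e) x.2.1 x.1.1) (L.σ (p e) z.1 s.1) ≤
        dist x.2.1 z.1 + |x.1.1 - s.1| * dist (p e) z.1 := by
      intro x
      have h1 := LocalGeodesicBicombing.dist_sigma_le hL he x.2.2 he z.2 x.1.2
      have h2 := L.geodesic y _ _ he z.2 _ x.1.2 _ s.2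
      have h3 := dist_triangle (L.σ (p e) x.2.1 x.1.1) (L.σ (p e) z.1 x.1.1) (L.σ (p e) z.1 s.1)
      rw [dist_self, mul_zero, zero_add] at h1
      have h4 : x.1.1 * dist x.2.1 z.1 ≤ dist x.2.1 z.1 :=
        mul_le_of_le_one_left dist_nonneg x.1.2.2
      linarith
    refine squeeze_zero (fun _ => dist_nonneg) hb ?_
    have : Continuous fun x : I × ball y (L.r y) =>
        dist x.2.1 z.1 + |x.1.1 - s.1| * dist (p e) z.1 := by fun_prop
    have h5 := this.tendsto (s, z)
    simpa using h5
  have hcont : Continuous fun x : I × ball y (L.r y) => Γ x.2 x.1 := by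
    refine hp.isLocalHomeomorph.continuous_lift (T2Space.isSeparatedMap p) ⟨_, hf⟩ ?_ ?_ ?_
    · ext x
      exact hΓ2 x.2 x.1 x.1.2
    · have : (fun a : ball y (L.r y) => Γ a ((0 : I) : ℝ)) = fun _ => e := by
        ext a; exact hΓ3 a
      simpa only [this] using continuous_const
    · intro a
      have := continuousOn_of_dist_le (hΓ1 a)
      exact this.comp_continuous continuous_subtype_val fun s => s.2
  classical
  refine ⟨fun z => if hz : z ∈ ball y (L.r y) then Γ ⟨z, hz⟩ 1 else e, ?_, ?_, ?_⟩
  · rw [continuousOn_iff_continuous_domRestrict]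
    have h1 : Continuous fun z : ball y (L.r y) => Γ z 1 :=
      hcont.comp (Continuous.prodMk_right (1 : I))
    refine h1.congr fun z => ?_
    rw [domRestrict_apply, dif_pos z.2]
  · intro z hz
    dsimp only
    rw [dif_pos hz, hΓ2 _ 1 ⟨zero_le_one, le_rfl⟩]
    exact L.target y _ _ he hz
  · dsimp only
    rw [dif_pos he]
    have := hΓ1 ⟨p e, he⟩ 1 ⟨zero_le_one, le_rfl⟩ 0 ⟨le_rfl, zero_le_one⟩
    rw [hΓ3, dist_self, zero_mul] at this
    exact dist_le_zero.1 this

open unitInterval in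
/-- Path lifting through a local isometry with complete source onto a space with a convex local
geodesic bicombing. -/
lemma exists_path_lift [CompleteSpace E] (hp : IsLocalIsometry p) {L : LocalGeodesicBicombing X}
    (hL : L.IsConvex) (γ : C(I, X)) (e : E) (he : p e = γ 0) :
    ∃ Γ : C(I, E), (∀ s, p (Γ s) = γ s) ∧ Γ 0 = e := by
  obtain ⟨t, t_0, t_mono, ⟨n_max, h_max⟩, t_sub⟩ :=
    exists_monotone_Icc_subset_open_cover_unitInterval
    (fun x => (isOpen_ball (x := x) (ε := L.r x)).preimage γ.continuous)
    fun t _ => mem_iUnion.2 ⟨γ t, mem_ball_self (L.r_pos _)⟩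
  suffices ∀ n, ∃ Γ : I → E, ContinuousOn Γ (Icc 0 (t n)) ∧
      (∀ s ∈ Icc 0 (t n), p (Γ s) = γ s) ∧ Γ 0 = e by
    obtain ⟨Γ, cont, eqOn, Γ_0⟩ := this n_max
    rw [h_max _ le_rfl] at cont eqOn
    have huniv : (Icc 0 1 : Set I) = univ := eq_univ_iff_forall.2 fun t => ⟨bot_le, le_top⟩
    rw [huniv] at cont
    exact ⟨⟨Γ, continuousOn_univ.mp cont⟩, fun s => eqOn s ⟨bot_le, le_top⟩, Γ_0⟩
  intro n
  induction n with
  | zero =>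
    refine ⟨fun _ => e, continuous_const.continuousOn, fun s hs => ?_, rfl⟩
    rw [t_0, Icc_self, mem_singleton_iff] at hs
    rw [hs, he]
  | succ n ih =>
    obtain ⟨Γ, cont, eqOn, Γ_0⟩ := ih
    obtain ⟨x, hx⟩ := t_sub n
    have pΓtn : p (Γ (t n)) = γ (t n) := eqOn _ ⟨t_0 ▸ t_mono n.zero_le, le_rfl⟩
    obtain ⟨q, q_cont, hpq, hq⟩ := hp.exists_section hL (y := x) (e := Γ (t n))
      (by rw [pΓtn]; exact hx ⟨le_rfl, t_mono n.le_succ⟩)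
    refine ⟨fun s => if s ≤ t n then Γ s else q (γ s), .if (fun s hs => ?_)
      (cont.mono fun _ h => ?_) ?_, fun s hs => ?_, ?_⟩
    · cases frontier_Iic_subset _ hs.2
      rw [← pΓtn, hq]
    · rw [closure_le_eq continuous_id' continuous_const] at h
      exact ⟨h.1.1, h.2⟩
    · refine q_cont.comp γ.continuous.continuousOn ?_
      simp_rw [not_le]
      intro s h
      have h2 : s ∈ {a : I | t n ≤ a} :=
        closure_lt_subset_le continuous_const continuous_id' h.2
      exact hx ⟨h2, h.1.2⟩
    · dsimp only
      split_ifs with h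
      · exact eqOn s ⟨hs.1, h⟩
      · exact hpq _ (hx ⟨(not_le.1 h).le, hs.2⟩)
    · dsimp only
      rwa [if_pos (t_0 ▸ t_mono n.zero_le)]

end IsLocalIsometry

open unitInterval in
/-- The locally consistent curves issuing from `x`, with the uniform metric. -/
def LocalGeodesicBicombing.curvesFrom {X : Type*} [MetricSpace X] (L : LocalGeodesicBicombing X)
    (x : X) : Set C(I, X) :=
  {f | f 0 = x ∧ L.IsLocallyConsistent (IccExtend zero_le_one f)}

namespace LocalGeodesicBicombing

open unitInterval

variable {X : Type*} [MetricSpace X] {L : LocalGeodesicBicombing X}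

/-- The restriction of a locally consistent curve to the unit interval. -/
def IsLocallyConsistent.toContinuousMap {c : ℝ → X} (hc : L.IsLocallyConsistent c) : C(I, X) :=
  ⟨fun t => c t, hc.continuousOn.comp_continuous continuous_subtype_val fun t => t.2⟩

lemma IsLocallyConsistent.iccExtend {c : ℝ → X} (hc : L.IsLocallyConsistent c) :
    L.IsLocallyConsistent (IccExtend zero_le_one hc.toContinuousMap) :=
  hc.congr fun t ht => by rw [IccExtend_of_mem _ _ ht]; rfl

lemma isClosed_curvesFrom [CompleteSpace X] (hL : L.IsConvex) (x : X) :
    IsClosed (L.curvesFrom x) := by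
  refine isClosed_of_closure_subset fun f hf => ?_
  rw [Metric.mem_closure_iff] at hf
  constructor
  · refine eq_of_forall_dist_le fun η hη => ?_
    obtain ⟨g, hg, hfg⟩ := hf η hη
    rw [← hg.1]
    exact (ContinuousMap.dist_apply_le_dist 0).trans hfg.le
  · refine IsLocallyConsistent.of_uniform_limit hL
      (f.continuous.Icc_extend').continuousOn fun η hη => ?_
    obtain ⟨g, hg, hfg⟩ := hf η hη
    refine ⟨_, hg.2, fun t ht => ?_⟩
    rw [IccExtend_of_mem _ _ ht, IccExtend_of_mem _ _ ht, dist_comm]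
    exact (ContinuousMap.dist_apply_le_dist _).trans hfg.le

/-- The endpoint map on locally consistent curves from `x` is a local isometry. -/
lemma isLocalIsometry_endpoint [CompleteSpace X] (hL : L.IsConvex) (x : X) :
    IsLocalIsometry fun f : L.curvesFrom x => f.1 1 := by
  intro f
  obtain ⟨ε, hε, hpert⟩ := f.2.2.exists_perturbation hL
  obtain ⟨ρ, hρ, hdom⟩ := f.2.2.exists_inDom_of_close
  have hval : ∀ (g : L.curvesFrom x) (t : I), IccExtend zero_le_one g.1 (t : ℝ) = g.1 t :=
    fun g t => IccExtend_val _ _ t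
  have hval0 : ∀ g : L.curvesFrom x, IccExtend zero_le_one g.1 (0 : ℝ) = x :=
    fun g => (hval g 0).trans g.2.1
  have hval1 : ∀ g : L.curvesFrom x, IccExtend zero_le_one g.1 (1 : ℝ) = g.1 1 :=
    fun g => hval g 1
  refine ⟨min ε ρ, lt_min hε hρ, fun g hg h hh => ?_, fun z hz => ?_⟩
  · refine le_antisymm (ContinuousMap.dist_apply_le_dist (1 : I)) ?_
    refine (ContinuousMap.dist_le dist_nonneg).2 fun t => ?_
    have hclose : ∀ k ∈ ball f (min ε ρ), ∀ t ∈ Icc (0:ℝ) 1,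
        IccExtend zero_le_one k.1 t ∈ ball (IccExtend zero_le_one f.1 t) ρ := by
      intro k hk t ht
      rw [IccExtend_of_mem _ _ ht, IccExtend_of_mem _ _ ht]
      exact (ContinuousMap.dist_apply_le_dist _).trans_lt (lt_of_lt_of_le hk (min_le_right _ _))
    have h1 := g.2.2.dist_le hL h.2.2
      (fun t ht => hdom t ht _ (hclose g hg t ht) _ (hclose h hh t ht)) t.2
    rw [hval, hval, hval0, hval0, hval1, hval1, dist_self, mul_zero, zero_add] at h1
    exact h1.trans (mul_le_of_le_one_left dist_nonneg t.2.2)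
  · have hz' : z ∈ ball (IccExtend zero_le_one f.1 (1:ℝ)) ε := by
      rw [hval1]; exact ball_subset_ball (min_le_left _ _) hz
    obtain ⟨c', hc', h0, h1, hdom'⟩ := hpert _ (mem_ball_self hε) z hz'
    refine ⟨⟨hc'.toContinuousMap, h0.trans (hval0 f), hc'.iccExtend⟩, ?_, h1⟩
    rw [Metric.mem_ball]
    refine lt_of_le_of_lt ?_ hz
    refine (ContinuousMap.dist_le dist_nonneg).2 fun t => ?_
    have h2 := f.2.2.dist_le hL hc' hdom' t.2
    rw [h0, h1, dist_self, mul_zero, zero_add, hval, hval1] at h2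
    rw [dist_comm, dist_comm z]
    exact h2.trans (mul_le_of_le_one_left dist_nonneg t.2.2)

/-- A locally consistent curve, as a path in the space of locally consistent curves. -/
lemma exists_tautological_lift (x : X) (f : L.curvesFrom x) :
    ∃ Γ : C(I, L.curvesFrom x), (∀ s, (Γ s).1 1 = f.1 s) ∧
      (Γ 0).1 = ContinuousMap.const I x ∧ Γ 1 = f := by
  have hF : Continuous fun p : I × I => f.1 (p.1 * p.2) := by fun_prop
  have hmem : ∀ s, ContinuousMap.curry ⟨_, hF⟩ s ∈ L.curvesFrom x := by
    intro s
    constructor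
    · change f.1 (s * 0) = x
      rw [mul_zero, f.2.1]
    · refine (f.2.2.restrict le_rfl s.2.1 s.2.2).congr fun t ht => ?_
      rw [IccExtend_of_mem _ _ ht]
      change _ = f.1 (s * ⟨t, ht⟩)
      have : (1 - t) * 0 + t * (s : ℝ) = ((s * ⟨t, ht⟩ : I) : ℝ) := by
        push_cast; ring
      beta_reduce
      rw [this, IccExtend_val]
  refine ⟨⟨fun s => ⟨_, hmem s⟩, ?_⟩, fun s => ?_, ?_, ?_⟩
  · exact (ContinuousMap.continuous _).subtype_mk _
  · change f.1 (s * 1) = f.1 s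
    rw [mul_one]
  · ext t
    change f.1 (0 * t) = x
    rw [zero_mul, f.2.1]
  · ext t
    change f.1 (1 * t) = f.1 t
    rw [one_mul]

/-- The constant curve. -/
lemma const_mem_curvesFrom (x : X) : ContinuousMap.const I x ∈ L.curvesFrom x :=
  ⟨rfl, (isLocallyConsistent_const L x).congr fun t ht => by
    rw [IccExtend_of_mem _ _ ht]; rfl⟩

theorem exists_isLocallyConsistent [CompleteSpace X] [PathConnectedSpace X] (hL : L.IsConvex)
    (x y : X) : ∃ c : ℝ → X, L.IsLocallyConsistent c ∧ c 0 = x ∧ c 1 = y := by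
  have : CompleteSpace (L.curvesFrom x) := (isClosed_curvesFrom hL x).completeSpace_coe
  obtain ⟨Γ, hΓ, -⟩ := (isLocalIsometry_endpoint hL x).exists_path_lift hL
    (PathConnectedSpace.somePath x y).toContinuousMap ⟨_, const_mem_curvesFrom x⟩
    (Path.source _).symm
  refine ⟨_, (Γ 1).2.2, ?_, ?_⟩
  · exact (IccExtend_val zero_le_one (Γ 1).1 (0 : I)).trans (Γ 1).2.1
  · refine (IccExtend_val zero_le_one (Γ 1).1 (1 : I)).trans ((hΓ 1).trans (Path.target _))

theorem IsLocallyConsistent.eqOn [CompleteSpace X] [SimplyConnectedSpace X] (hL : L.IsConvex)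
    {c c' : ℝ → X} (hc : L.IsLocallyConsistent c) (hc' : L.IsLocallyConsistent c')
    (h0 : c 0 = c' 0) (h1 : c 1 = c' 1) : EqOn c c' (Icc 0 1) := by
  have : CompleteSpace (L.curvesFrom (c 0)) := (isClosed_curvesFrom hL (c 0)).completeSpace_coe
  have hp := isLocalIsometry_endpoint hL (c 0)
  let γ : Path (c 0) (c 1) := ⟨hc.toContinuousMap, rfl, rfl⟩
  let γ' : Path (c 0) (c 1) := ⟨hc'.toContinuousMap, h0.symm, h1.symm⟩
  obtain ⟨H⟩ := SimplyConnectedSpace.paths_homotopic γ γ'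
  let f : L.curvesFrom (c 0) := ⟨hc.toContinuousMap, rfl, hc.iccExtend⟩
  let f' : L.curvesFrom (c 0) := ⟨hc'.toContinuousMap, h0.symm, hc'.iccExtend⟩
  let e : L.curvesFrom (c 0) := ⟨_, const_mem_curvesFrom (c 0)⟩
  have hlift : ∀ t : I, ∃ Γ : C(I, L.curvesFrom (c 0)), (∀ s, (Γ s).1 1 = H (t, s)) ∧ Γ 0 = e :=
    fun t => hp.exists_path_lift hL ⟨fun s => H (t, s), by fun_prop⟩ e (H.source t).symm
  choose Γ hΓ hΓ0 using hlift
  have hmon := hp.isLocalHomeomorph.monodromy_theorem (T2Space.isSeparatedMap _) H Γ hΓ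
    (fun t => (hΓ0 t).trans (hΓ0 0).symm) 1
  have huniq : ∀ (t : I) (g : L.curvesFrom (c 0)), (∀ s, H (t, s) = g.1 s) → Γ t 1 = g := by
    intro t g hg
    obtain ⟨Γ', h1, h2, h3⟩ := exists_tautological_lift (c 0) g
    rw [← h3]
    refine congr_fun ((T2Space.isSeparatedMap _).eq_of_comp_eq
      hp.isLocalHomeomorph.isLocallyInjective (Γ t).continuous Γ'.continuous ?_ 0
      ((hΓ0 t).trans (Subtype.ext h2.symm))) 1
    ext s
    exact (hΓ t s).trans ((hg s).trans (h1 s).symm)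
  have hff : f' = f := by
    rw [← huniq 1 f' fun s => H.apply_one s, hmon]
    exact huniq 0 f fun s => H.apply_zero s
  intro t ht
  exact (congr_arg (fun g : L.curvesFrom (c 0) => g.1 ⟨t, ht⟩) hff).symm

end LocalGeodesicBicombing

lemma exists_uniform_of_locally {P : ℝ → ℝ → Prop}
    (h : ∀ t ∈ Icc (0:ℝ) 1, ∃ ε > 0, ∀ u ∈ Icc (0:ℝ) 1 ∩ Ioo (t - ε) (t + ε),
      ∀ v ∈ Icc (0:ℝ) 1 ∩ Ioo (t - ε) (t + ε), P u v) :
    ∃ n : ℕ, 0 < n ∧ ∀ u ∈ Icc (0:ℝ) 1, ∀ v ∈ Icc (0:ℝ) 1, |u - v| ≤ 1 / n → P u v := by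
  choose! ε hε hP using h
  obtain ⟨δ, hδ, hδP⟩ := lebesgue_number_lemma_of_metric
    (c := fun t : Icc (0:ℝ) 1 => Ioo (t.1 - ε t) (t.1 + ε t)) (isCompact_Icc (a := (0:ℝ)) (b := 1))
    (fun _ => isOpen_Ioo) fun t ht => mem_iUnion.2
      ⟨⟨t, ht⟩, by simp only; linarith [hε t ht], by simp only; linarith [hε t ht]⟩
  obtain ⟨n, hn⟩ := exists_nat_one_div_lt hδ
  refine ⟨n + 1, n.succ_pos, fun u hu v hv huv => ?_⟩
  obtain ⟨i, hi⟩ := hδP u hu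
  refine hP i i.2 u ⟨hu, hi (mem_ball_self hδ)⟩ v ⟨hv, hi ?_⟩
  rw [Metric.mem_ball, dist_comm, Real.dist_eq]
  push_cast at huv
  linarith

lemma eVariationOn_Icc_of_dist_eq {X : Type*} [MetricSpace X] {c : ℝ → X} {a b l : ℝ} (hl : 0 ≤ l)
    (hab : a ≤ b) (h : ∀ u ∈ Icc a b, ∀ v ∈ Icc a b, dist (c u) (c v) = |u - v| * l) :
    eVariationOn c (Icc a b) = ENNReal.ofReal ((b - a) * l) := by
  have h1 : eVariationOn c (Icc a b) = eVariationOn (fun t => t * l) (Icc a b) := by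
    refine iSup_congr fun p => Finset.sum_congr rfl fun i _ => ?_
    rw [edist_dist, edist_dist, h _ (p.2.2.2 _) _ (p.2.2.2 _), Real.dist_eq, ← sub_mul, abs_mul,
      abs_of_nonneg hl]
  have hm : MonotoneOn (fun t : ℝ => t * l) (Icc a b) :=
    fun u _ v _ huv => mul_le_mul_of_nonneg_right huv hl
  have h2 := hm.eVariationOn_eq ⟨le_rfl, hab⟩ ⟨hab, le_rfl⟩
  rwa [inter_self, ← sub_mul, ← h1] at h2

lemma curveLength_nonneg {X : Type*} [MetricSpace X] (c : ℝ → X) : 0 ≤ curveLength c :=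
  ENNReal.toReal_nonneg

namespace LocalGeodesicBicombing

variable {X : Type*} [MetricSpace X] {L : LocalGeodesicBicombing X}

namespace IsLocallyConsistent

lemma exists_global_speed {c : ℝ → X} (hc : L.IsLocallyConsistent c) :
    ∃ l ≥ 0, ∀ t ∈ Icc (0:ℝ) 1, ∃ ε > 0, ∀ u ∈ Icc (0:ℝ) 1 ∩ Ioo (t - ε) (t + ε),
      ∀ v ∈ Icc (0:ℝ) 1 ∩ Ioo (t - ε) (t + ε), dist (c u) (c v) = |u - v| * l := by
  have hsp : ∀ t : Icc (0:ℝ) 1, _ := fun t => hc.exists_speed t.2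
  choose l hl ε hε h using hsp
  have hconst : IsLocallyConstant l := by
    rw [IsLocallyConstant.iff_eventually_eq]
    intro t
    filter_upwards [ball_mem_nhds t (hε t)] with y hy
    rw [Metric.mem_ball, Subtype.dist_eq, Real.dist_eq, abs_lt] at hy
    obtain ⟨δ, hδ, h1, h2, h3, h4⟩ : ∃ δ > 0, δ < ε y ∧ δ < ε t - (y - t) ∧ δ < ε t + (y - t) ∧
        δ ≤ 1 / 2 := by
      set m := min (min (ε y) (1 / 2)) (min (ε t - (y - t)) (ε t + (y - t))) with hm
      have hm0 : 0 < m := lt_min (lt_min (hε y) (by norm_num))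
        (lt_min (by linarith) (by linarith))
      have e1 : m ≤ ε y := (min_le_left _ _).trans (min_le_left _ _)
      have e2 : m ≤ 1 / 2 := (min_le_left _ _).trans (min_le_right _ _)
      have e3 : m ≤ ε t - (y - t) := (min_le_right _ _).trans (min_le_left _ _)
      have e4 : m ≤ ε t + (y - t) := (min_le_right _ _).trans (min_le_right _ _)
      exact ⟨m / 2, by linarith, by linarith, by linarith, by linarith, by linarith⟩
    obtain ⟨v, hv, hvy⟩ : ∃ v ∈ Icc (0:ℝ) 1, |v - y| = δ := by
      rcases le_total (y : ℝ) (1 / 2) with hy2 | hy2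
      · exact ⟨y + δ, ⟨by linarith [y.2.1], by linarith⟩, by
          rw [add_sub_cancel_left, abs_of_pos hδ]⟩
      · exact ⟨y - δ, ⟨by linarith, by linarith [y.2.2]⟩, by
          rw [sub_sub_cancel_left, abs_neg, abs_of_pos hδ]⟩
    have hv2 : |v - y| ≤ δ := hvy.le
    rw [abs_le] at hv2
    have a1 := h y v ⟨hv, by linarith, by linarith⟩ y ⟨y.2, by linarith [hε y], by linarith [hε y]⟩
    have a2 := h t v ⟨hv, by linarith, by linarith⟩ y ⟨y.2, by linarith, by linarith⟩
    rw [a1, hvy] at a2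
    exact mul_left_cancel₀ hδ.ne' a2
  refine ⟨l ⟨0, le_rfl, zero_le_one⟩, hl _, fun t ht => ⟨ε ⟨t, ht⟩, hε _, ?_⟩⟩
  rw [hconst.apply_eq_of_preconnectedSpace ⟨0, le_rfl, zero_le_one⟩ ⟨t, ht⟩]
  exact h ⟨t, ht⟩

lemma exists_length {c : ℝ → X} (hc : L.IsLocallyConsistent c) :
    ∃ l ≥ 0, eVariationOn c (Icc 0 1) = ENNReal.ofReal l ∧
      ∀ t ∈ Icc (0:ℝ) 1, ∃ ε > 0, ∀ u ∈ Icc (0:ℝ) 1 ∩ Ioo (t - ε) (t + ε),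
        ∀ v ∈ Icc (0:ℝ) 1 ∩ Ioo (t - ε) (t + ε), dist (c u) (c v) = |u - v| * l := by
  obtain ⟨l, hl, h⟩ := hc.exists_global_speed
  refine ⟨l, hl, ?_, h⟩
  obtain ⟨n, hn, hP⟩ := exists_uniform_of_locally h
  have hn' : (0:ℝ) < n := Nat.cast_pos.2 hn
  have key : ∀ k : ℕ, k ≤ n →
      eVariationOn c (Icc 0 ((k:ℝ) / n)) = ENNReal.ofReal ((k:ℝ) / n * l) := by
    intro k
    induction k with
    | zero =>
      intro _
      simp
    | succ k ih =>
      intro hk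
      have hk1 : ((k + 1 : ℕ) : ℝ) / n ≤ 1 := (div_le_one hn').2 (by exact_mod_cast hk)
      have hk0 : (0:ℝ) ≤ (k:ℝ) / n := by positivity
      have hkk : ((k + 1 : ℕ) : ℝ) / n = (k:ℝ) / n + 1 / n := by push_cast; ring
      have hle : (k:ℝ) / n ≤ ((k + 1 : ℕ) : ℝ) / n := by
        rw [hkk]; have : (0:ℝ) ≤ 1 / n := by positivity
        linarith
      have h1 := eVariationOn.Icc_add_Icc c (s := univ) hk0 hle (mem_univ _)
      simp only [univ_inter] at h1
      rw [← h1, ih (by omega), eVariationOn_Icc_of_dist_eq hl hle,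
        ← ENNReal.ofReal_add (by positivity) (mul_nonneg (by linarith) hl)]
      · congr 1; ring
      · intro u hu v hv
        refine hP u ⟨hk0.trans hu.1, hu.2.trans hk1⟩ v ⟨hk0.trans hv.1, hv.2.trans hk1⟩ ?_
        rw [abs_le]
        constructor <;> linarith [hu.1, hu.2, hv.1, hv.2]
  have := key n le_rfl
  rwa [div_self hn'.ne', one_mul] at this

lemma eVariationOn_eq {c : ℝ → X} (hc : L.IsLocallyConsistent c) :
    eVariationOn c (Icc 0 1) = ENNReal.ofReal (curveLength c) := by
  obtain ⟨l, hl, h, -⟩ := hc.exists_length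
  rw [curveLength, h, ENNReal.toReal_ofReal hl]

lemma isLocalGeodesic {c : ℝ → X} (hc : L.IsLocallyConsistent c) : IsLocalGeodesic c := by
  obtain ⟨l, hl, h, hloc⟩ := hc.exists_length
  rw [IsLocalGeodesic, curveLength, h, ENNReal.toReal_ofReal hl]
  exact hloc

/-- The length of a locally consistent curve is its initial speed. -/
lemma curveLength_eq {c : ℝ → X} (hc : L.IsLocallyConsistent c) {l ε : ℝ} (hε : 0 < ε)
    (h : ∀ t ∈ Icc (0:ℝ) 1, t < ε → dist (c t) (c 0) = t * l) : curveLength c = l := by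
  obtain ⟨δ, hδ, hloc⟩ := hc.isLocalGeodesic 0 ⟨le_rfl, zero_le_one⟩
  obtain ⟨t, ht, ht1, htε, htδ⟩ : ∃ t > 0, t ≤ 1 ∧ t < ε ∧ t < δ := by
    have hm : 0 < min 1 (min ε δ) := lt_min one_pos (lt_min hε hδ)
    have e1 : min 1 (min ε δ) ≤ 1 := min_le_left _ _
    have e2 : min 1 (min ε δ) ≤ ε := (min_le_right _ _).trans (min_le_left _ _)
    have e3 : min 1 (min ε δ) ≤ δ := (min_le_right _ _).trans (min_le_right _ _)
    exact ⟨min 1 (min ε δ) / 2, by linarith, by linarith, by linarith, by linarith⟩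
  have h1 := hloc t ⟨⟨ht.le, ht1⟩, by linarith, by linarith⟩ 0
    ⟨⟨le_rfl, zero_le_one⟩, by linarith, by linarith⟩
  rw [h t ⟨ht.le, ht1⟩ htε, sub_zero, abs_of_pos ht] at h1
  exact (mul_left_cancel₀ ht.ne' h1).symm

lemma curveLength_restrict {c : ℝ → X} (hc : L.IsLocallyConsistent c) {a b : ℝ} (ha : 0 ≤ a)
    (hab : a ≤ b) (hb : b ≤ 1) :
    curveLength (fun s => c ((1 - s) * a + s * b)) = (b - a) * curveLength c := by
  obtain ⟨δ, hδ, hloc⟩ := hc.isLocalGeodesic a ⟨ha, hab.trans hb⟩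
  refine (hc.restrict ha hab hb).curveLength_eq hδ fun t ht htδ => ?_
  have e1 : (1 - t) * a + t * b = a + t * (b - a) := by ring
  have e2 : (1 - (0:ℝ)) * a + 0 * b = a := by ring
  have e3 : 0 ≤ t * (b - a) := mul_nonneg ht.1 (by linarith)
  have e4 : t * (b - a) ≤ t := mul_le_of_le_one_right ht.1 (by linarith)
  have e5 : t * (b - a) ≤ b - a := mul_le_of_le_one_left (by linarith) ht.2
  rw [e1, e2, hloc _ ⟨⟨by linarith, by linarith⟩, by linarith, by linarith⟩ a
    ⟨⟨ha, hab.trans hb⟩, by linarith, by linarith⟩, add_sub_cancel_left, abs_of_nonneg e3,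
    mul_assoc]

lemma dist_le_curveLength {c : ℝ → X} (hc : L.IsLocallyConsistent c) :
    dist (c 0) (c 1) ≤ curveLength c := by
  have h := eVariationOn.edist_le c (s := Icc (0:ℝ) 1) (x := 0) (y := 1)
    ⟨le_rfl, zero_le_one⟩ ⟨zero_le_one, le_rfl⟩
  rw [hc.eVariationOn_eq, edist_dist] at h
  exact (ENNReal.ofReal_le_ofReal_iff (curveLength_nonneg c)).1 h

lemma curveLength_le (hL : L.IsConvex) {c c' : ℝ → X} (hc : L.IsLocallyConsistent c)
    (hc' : L.IsLocallyConsistent c') (h0 : c 0 = c' 0)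
    (h : ∀ t ∈ Icc (0:ℝ) 1, L.InDom (c t) (c' t)) :
    curveLength c' ≤ curveLength c + dist (c 1) (c' 1) := by
  have h0I : (0:ℝ) ∈ Icc (0:ℝ) 1 := ⟨le_rfl, zero_le_one⟩
  obtain ⟨ε, hε, hloc⟩ := hc.isLocalGeodesic 0 h0I
  obtain ⟨δ, hδ, hloc'⟩ := hc'.isLocalGeodesic 0 h0I
  obtain ⟨t, ht, ht1, htε, htδ⟩ : ∃ t > 0, t ≤ 1 ∧ t < ε ∧ t < δ := by
    have hm : 0 < min 1 (min ε δ) := lt_min one_pos (lt_min hε hδ)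
    have e1 : min 1 (min ε δ) ≤ 1 := min_le_left _ _
    have e2 : min 1 (min ε δ) ≤ ε := (min_le_right _ _).trans (min_le_left _ _)
    have e3 : min 1 (min ε δ) ≤ δ := (min_le_right _ _).trans (min_le_right _ _)
    exact ⟨min 1 (min ε δ) / 2, by linarith, by linarith, by linarith, by linarith⟩
  have h1 := hloc 0 ⟨h0I, by linarith, by linarith⟩ t ⟨⟨ht.le, ht1⟩, by linarith, by linarith⟩
  have h2 := hloc' 0 ⟨h0I, by linarith, by linarith⟩ t ⟨⟨ht.le, ht1⟩, by linarith, by linarith⟩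
  have h3 := hc.dist_le hL hc' h (t := t) ⟨ht.le, ht1⟩
  have h4 := dist_triangle (c' 0) (c t) (c' t)
  rw [zero_sub, abs_neg, abs_of_pos ht] at h1 h2
  rw [h0, dist_self, mul_zero, zero_add] at h3
  rw [← h0, h1, h0, h2] at h4
  refine le_of_mul_le_mul_left ?_ ht
  rw [mul_add]
  linarith

end IsLocallyConsistent

lemma InDom.curveLength_eq {a b : X} (h : L.InDom a b) : curveLength (L.σ a b) = dist a b :=
  h.isLocallyConsistent.curveLength_eq one_pos fun t ht _ => by
    rw [h.dist_eq ht ⟨le_rfl, zero_le_one⟩, sub_zero, abs_of_nonneg ht.1]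

lemma curveLength_congr {c c' : ℝ → X} (h : EqOn c c' (Icc 0 1)) :
    curveLength c = curveLength c' := by
  rw [curveLength, curveLength, eVariationOn.eq_of_eqOn h]

end LocalGeodesicBicombing

namespace LocalGeodesicBicombing

variable {X : Type*} [MetricSpace X] {L : LocalGeodesicBicombing X}

/-- `g x y` is a locally consistent curve from `x` to `y`, and it is the only one. -/
structure IsGlobalBicombing (L : LocalGeodesicBicombing X) (g : X → X → ℝ → X) : Prop where
  apply_zero : ∀ x y, g x y 0 = x
  apply_one : ∀ x y, g x y 1 = y
  isLocallyConsistent : ∀ x y, L.IsLocallyConsistent (g x y)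
  eqOn : ∀ c, L.IsLocallyConsistent c → EqOn c (g (c 0) (c 1)) (Icc 0 1)

theorem exists_isGlobalBicombing [CompleteSpace X] [SimplyConnectedSpace X] (hL : L.IsConvex) :
    ∃ g, L.IsGlobalBicombing g := by
  choose g hg h0 h1 using exists_isLocallyConsistent (L := L) hL
  exact ⟨g, h0, h1, hg, fun c hc => hc.eqOn hL (hg _ _) (h0 _ _).symm (h1 _ _).symm⟩

namespace IsGlobalBicombing

variable {g : X → X → ℝ → X}

lemma consistent (hg : L.IsGlobalBicombing g) (x y : X) {a b : ℝ} (ha : 0 ≤ a) (hab : a ≤ b)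
    (hb : b ≤ 1) : EqOn (fun t => g x y ((1 - t) * a + t * b)) (g (g x y a) (g x y b))
      (Icc 0 1) := by
  have h := hg.eqOn _ ((hg.isLocallyConsistent x y).restrict ha hab hb)
  simpa using h

lemma eqOn_sigma (hg : L.IsGlobalBicombing g) {x y : X} (h : L.InDom x y) :
    EqOn (L.σ x y) (g x y) (Icc 0 1) := by
  have h1 := hg.eqOn _ h.isLocallyConsistent
  rwa [h.source, h.target] at h1

lemma consistentWith (hg : L.IsGlobalBicombing g) (x y : X) : L.ConsistentWith (g x y) :=
  fun _ _ ha hab hb h _ ht =>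
    (hg.consistent x y ha hab hb ht).trans (hg.eqOn_sigma h ht).symm

lemma length_of_inDom (hg : L.IsGlobalBicombing g) {x y : X} (h : L.InDom x y) :
    curveLength (g x y) = dist x y := by
  rw [← curveLength_congr (hg.eqOn_sigma h), h.curveLength_eq]

lemma length_self (hg : L.IsGlobalBicombing g) (x : X) : curveLength (g x x) = 0 := by
  rw [hg.length_of_inDom (InDom.refl L x), dist_self]

lemma length_sub (hg : L.IsGlobalBicombing g) (x y : X) {a b : ℝ} (ha : 0 ≤ a) (hab : a ≤ b)
    (hb : b ≤ 1) : curveLength (g (g x y a) (g x y b)) = (b - a) * curveLength (g x y) := by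
  rw [← curveLength_congr (hg.consistent x y ha hab hb),
    (hg.isLocallyConsistent x y).curveLength_restrict ha hab hb]

lemma dist_le_length (hg : L.IsGlobalBicombing g) (x y : X) : dist x y ≤ curveLength (g x y) := by
  have h := (hg.isLocallyConsistent x y).dist_le_curveLength
  rwa [hg.apply_zero, hg.apply_one] at h

/-- Curves of the global bicombing with nearby endpoints are uniformly close. -/
lemma exists_inDom [CompleteSpace X] (hL : L.IsConvex) (hg : L.IsGlobalBicombing g) (x y : X) :
    ∃ ε > 0, ∀ x' ∈ ball x ε, ∀ x'' ∈ ball x ε, ∀ y' ∈ ball y ε, ∀ y'' ∈ ball y ε,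
      ∀ t ∈ Icc (0:ℝ) 1, L.InDom (g x' y' t) (g x'' y'' t) := by
  have hc := hg.isLocallyConsistent x y
  obtain ⟨ε, hε, hpert⟩ := hc.exists_perturbation hL
  obtain ⟨ρ, hρ, hdom⟩ := hc.exists_inDom_of_close
  rw [hg.apply_zero, hg.apply_one] at hpert
  have key : ∀ x' ∈ ball x (min ε ρ), ∀ y' ∈ ball y (min ε ρ), ∀ t ∈ Icc (0:ℝ) 1,
      g x' y' t ∈ ball (g x y t) ρ := by
    intro x' hx' y' hy' t ht
    obtain ⟨c', hc', h0, h1, hd⟩ := hpert x' (ball_subset_ball (min_le_left _ _) hx') y'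
      (ball_subset_ball (min_le_left _ _) hy')
    have h2 := hg.eqOn c' hc' ht
    rw [h0, h1] at h2
    have h3 := hc.dist_le hL hc' hd ht
    rw [hg.apply_zero, hg.apply_one, h0, h1] at h3
    rw [← h2, Metric.mem_ball, dist_comm]
    have h4 : dist x x' < ρ := by
      rw [dist_comm]; exact ball_subset_ball (min_le_right _ _) hx'
    have h5 : dist y y' < ρ := by
      rw [dist_comm]; exact ball_subset_ball (min_le_right _ _) hy'
    refine h3.trans_lt ?_
    rcases ht.1.eq_or_lt with h | h
    · rw [← h]; linarith
    · nlinarith [ht.2, mul_lt_mul_of_pos_left h5 h,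
        mul_le_mul_of_nonneg_left h4.le (sub_nonneg.2 ht.2)]
  exact ⟨min ε ρ, lt_min hε hρ, fun x' hx' x'' hx'' y' hy' y'' hy'' t ht =>
    hdom t ht _ (key x' hx' y' hy' t ht) _ (key x'' hx'' y'' hy'' t ht)⟩

lemma exists_subdivision [CompleteSpace X] (hL : L.IsConvex) (hg : L.IsGlobalBicombing g)
    {x y : ℝ → X} (hx : ContinuousOn x (Icc 0 1)) (hy : ContinuousOn y (Icc 0 1)) :
    ∃ n : ℕ, 0 < n ∧ ∀ u ∈ Icc (0:ℝ) 1, ∀ v ∈ Icc (0:ℝ) 1, |u - v| ≤ 1 / n →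
      ∀ t ∈ Icc (0:ℝ) 1, L.InDom (g (x u) (y u) t) (g (x v) (y v) t) := by
  refine exists_uniform_of_locally fun t ht => ?_
  obtain ⟨ε, hε, h⟩ := hg.exists_inDom hL (x t) (y t)
  obtain ⟨δ, hδ, h1⟩ := Metric.continuousOn_iff.1 hx t ht ε hε
  obtain ⟨δ', hδ', h2⟩ := Metric.continuousOn_iff.1 hy t ht ε hε
  have key : ∀ u ∈ Icc (0:ℝ) 1 ∩ Ioo (t - min δ δ') (t + min δ δ'),
      x u ∈ ball (x t) ε ∧ y u ∈ ball (y t) ε := by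
    intro u hu
    have h3 : dist u t < min δ δ' := by
      rw [Real.dist_eq, abs_lt]
      constructor <;> linarith [hu.2.1, hu.2.2]
    exact ⟨h1 u hu.1 (h3.trans_le (min_le_left _ _)), h2 u hu.1 (h3.trans_le (min_le_right _ _))⟩
  exact ⟨min δ δ', lt_min hδ hδ', fun u hu v hv =>
    h _ (key u hu).1 _ (key v hv).1 _ (key u hu).2 _ (key v hv).2⟩

lemma ofReal_length_le [CompleteSpace X] (hL : L.IsConvex) (hg : L.IsGlobalBicombing g) (x : X)
    {γ : ℝ → X} (hγ : ContinuousOn γ (Icc 0 1)) :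
    ENNReal.ofReal (curveLength (g x (γ 1))) ≤
      ENNReal.ofReal (curveLength (g x (γ 0))) + eVariationOn γ (Icc 0 1) := by
  obtain ⟨n, hn, h⟩ := hg.exists_subdivision hL (continuousOn_const (c := x)) hγ
  have hn' : (0:ℝ) < n := Nat.cast_pos.2 hn
  have hmem : ∀ i ≤ n, ((i:ℝ) / n) ∈ Icc (0:ℝ) 1 := fun i hi =>
    ⟨by positivity, (div_le_one hn').2 (by exact_mod_cast hi)⟩
  have key : ∀ k ≤ n, ENNReal.ofReal (curveLength (g x (γ ((k:ℝ) / n)))) ≤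
      ENNReal.ofReal (curveLength (g x (γ 0))) +
        ∑ i ∈ Finset.range k, edist (γ (((i + 1 : ℕ) : ℝ) / n)) (γ ((i:ℝ) / n)) := by
    intro k
    induction k with
    | zero => intro _; simp
    | succ k ih =>
      intro hk
      rw [Finset.sum_range_succ, ← add_assoc]
      refine le_trans ?_ (add_le_add_left (ih (by omega)) _)
      rw [edist_dist, ← ENNReal.ofReal_add (curveLength_nonneg _) dist_nonneg]
      refine ENNReal.ofReal_le_ofReal ?_
      have h1 := (hg.isLocallyConsistent x (γ ((k:ℝ) / n))).curveLength_le hL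
        (hg.isLocallyConsistent x (γ (((k + 1 : ℕ) : ℝ) / n)))
        ((hg.apply_zero _ _).trans (hg.apply_zero _ _).symm)
        (h _ (hmem k (by omega)) _ (hmem (k + 1) hk) (le_of_eq ?_))
      · rwa [hg.apply_one, hg.apply_one, dist_comm] at h1
      · rw [← sub_div, abs_div, abs_of_pos hn']
        push_cast
        rw [sub_add_cancel_left, abs_neg, abs_one]
  have h1 := key n le_rfl
  rw [div_self hn'.ne'] at h1
  refine h1.trans (add_le_add_right ?_ _)
  refine eVariationOn.sum_le_of_monotoneOn_Iic (u := fun i : ℕ => (i:ℝ) / n) ?_ hmem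
  intro i _ j _ hij
  exact div_le_div_of_nonneg_right (by exact_mod_cast hij) hn'.le

lemma length_le_of_eVariationOn [CompleteSpace X] (hL : L.IsConvex) (hg : L.IsGlobalBicombing g)
    {x y : X} {γ : ℝ → X} (hγ : ContinuousOn γ (Icc 0 1)) (h0 : γ 0 = x) (h1 : γ 1 = y) :
    ENNReal.ofReal (curveLength (g x y)) ≤ eVariationOn γ (Icc 0 1) := by
  have h := hg.ofReal_length_le hL x hγ
  rwa [h0, h1, hg.length_self, ENNReal.ofReal_zero, zero_add] at h

lemma lengthMetric_eq [CompleteSpace X] (hL : L.IsConvex) (hg : L.IsGlobalBicombing g) (x y : X) :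
    lengthMetric x y = curveLength (g x y) := by
  have hc := hg.isLocallyConsistent x y
  rw [lengthMetric, curveLength]
  congr 1
  refine le_antisymm ?_ ?_
  · exact iInf_le_of_le (g x y) (iInf_le_of_le hc.continuousOn
      (iInf_le_of_le (hg.apply_zero x y) (iInf_le_of_le (hg.apply_one x y) le_rfl)))
  · rw [hc.eVariationOn_eq]
    exact le_iInf fun γ => le_iInf fun hγ => le_iInf fun h0 => le_iInf fun h1 =>
      hg.length_le_of_eVariationOn hL hγ h0 h1

lemma length_triangle [CompleteSpace X] (hL : L.IsConvex) (hg : L.IsGlobalBicombing g)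
    (x y z : X) : curveLength (g x z) ≤ curveLength (g x y) + curveLength (g y z) := by
  have hc := hg.isLocallyConsistent y z
  have h := hg.ofReal_length_le hL x hc.continuousOn
  rw [hc.eVariationOn_eq, hg.apply_zero, hg.apply_one,
    ← ENNReal.ofReal_add (curveLength_nonneg _) (curveLength_nonneg _)] at h
  exact (ENNReal.ofReal_le_ofReal_iff
    (add_nonneg (curveLength_nonneg _) (curveLength_nonneg _))).1 h

lemma length_comm [CompleteSpace X] (hL : L.IsConvex) (hg : L.IsGlobalBicombing g) (x y : X) :
    curveLength (g x y) = curveLength (g y x) := by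
  have key : ∀ x y, curveLength (g x y) ≤ curveLength (g y x) := by
    intro x y
    have hc := hg.isLocallyConsistent y x
    have hmaps : MapsTo (fun t : ℝ => 1 - t) (Icc 0 1) (Icc 0 1) :=
      fun t ht => ⟨by linarith [ht.2], by linarith [ht.1]⟩
    have h := hg.length_le_of_eVariationOn hL (x := x) (y := y) (γ := g y x ∘ fun t => 1 - t)
      (hc.continuousOn.comp (by fun_prop) hmaps) (by simp [hg.apply_one])
      (by simp [hg.apply_zero])
    have h1 := h.trans (eVariationOn.comp_le_of_antitoneOn (g y x) (fun t : ℝ => 1 - t)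
      (fun a _ b _ hab => by simp only; linarith) hmaps)
    rw [hc.eVariationOn_eq] at h1
    exact (ENNReal.ofReal_le_ofReal_iff (curveLength_nonneg _)).1 h1
  exact le_antisymm (key x y) (key y x)

lemma length_le_of_endpoints [CompleteSpace X] (hL : L.IsConvex) (hg : L.IsGlobalBicombing g)
    (x y x' y' : X) {t : ℝ} (ht : t ∈ Icc (0:ℝ) 1) :
    curveLength (g (g x y t) (g x' y' t)) ≤
      (1 - t) * curveLength (g x x') + t * curveLength (g y y') := by
  obtain ⟨n, hn, h⟩ := hg.exists_subdivision hL (hg.isLocallyConsistent x x').continuousOn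
    (hg.isLocallyConsistent y y').continuousOn
  have hn' : (0:ℝ) < n := Nat.cast_pos.2 hn
  set D := (1 - t) * curveLength (g x x') + t * curveLength (g y y') with hD
  set P : ℕ → X := fun k => g (g x x' ((k:ℝ) / n)) (g y y' ((k:ℝ) / n)) t with hP
  have step : ∀ k < n, curveLength (g (P k) (P (k + 1))) ≤ 1 / n * D := by
    intro k hk
    have hk0 : (0:ℝ) ≤ (k:ℝ) / n := by positivity
    have hk1 : ((k + 1 : ℕ) : ℝ) / n ≤ 1 := (div_le_one hn').2 (by exact_mod_cast hk)
    have hkk : ((k + 1 : ℕ) : ℝ) / n - (k:ℝ) / n = 1 / n := by push_cast; ring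
    have hpos : (0:ℝ) < 1 / n := by positivity
    have hle : (k:ℝ) / n ≤ ((k + 1 : ℕ) : ℝ) / n := by linarith
    have hdom := h _ ⟨hk0, hle.trans hk1⟩ _ ⟨hk0.trans hle, hk1⟩
      (by rw [abs_sub_comm, hkk, abs_of_pos hpos])
    rw [hg.length_of_inDom (hdom t ht)]
    have h1 := (hg.isLocallyConsistent _ _).dist_le hL (hg.isLocallyConsistent _ _) hdom ht
    simp only [hg.apply_zero, hg.apply_one] at h1
    have h2 := hg.dist_le_length (g x x' ((k:ℝ) / n)) (g x x' (((k + 1 : ℕ) : ℝ) / n))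
    have h3 := hg.dist_le_length (g y y' ((k:ℝ) / n)) (g y y' (((k + 1 : ℕ) : ℝ) / n))
    rw [hg.length_sub _ _ hk0 hle hk1, hkk] at h2 h3
    have h4 := mul_le_mul_of_nonneg_left h2 (sub_nonneg.2 ht.2)
    have h5 := mul_le_mul_of_nonneg_left h3 ht.1
    refine h1.trans ?_
    rw [hD]
    linarith
  have key : ∀ k ≤ n, curveLength (g (P 0) (P k)) ≤ (k:ℝ) / n * D := by
    intro k
    induction k with
    | zero => intro _; rw [hg.length_self]; simp
    | succ k ih =>
      intro hk
      have h1 := hg.length_triangle hL (P 0) (P k) (P (k + 1))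
      have h2 := ih (by omega)
      have h3 := step k (by omega)
      have h4 : ((k + 1 : ℕ) : ℝ) / n * D = (k:ℝ) / n * D + 1 / n * D := by push_cast; ring
      linarith
  have h1 := key n le_rfl
  simpa [hP, div_self hn'.ne', hg.apply_zero, hg.apply_one] using h1

lemma convexOn_length [CompleteSpace X] (hL : L.IsConvex) (hg : L.IsGlobalBicombing g)
    (x y x' y' : X) :
    ConvexOn ℝ (Icc (0:ℝ) 1) fun t => curveLength (g (g x y t) (g x' y' t)) := by
  have key : ∀ a ∈ Icc (0:ℝ) 1, ∀ b ∈ Icc (0:ℝ) 1, a ≤ b → ∀ s ∈ Icc (0:ℝ) 1,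
      curveLength (g (g x y ((1 - s) * a + s * b)) (g x' y' ((1 - s) * a + s * b))) ≤
        (1 - s) * curveLength (g (g x y a) (g x' y' a)) +
          s * curveLength (g (g x y b) (g x' y' b)) := by
    intro a ha b hb hab s hs
    have h1 := hg.consistent x y ha.1 hab hb.2 hs
    have h2 := hg.consistent x' y' ha.1 hab hb.2 hs
    beta_reduce at h1 h2
    rw [h1, h2]
    exact hg.length_le_of_endpoints hL _ _ _ _ hs
  refine ⟨convex_Icc 0 1, fun a ha b hb α β hα hβ hαβ => ?_⟩
  simp only [smul_eq_mul]
  rcases le_total a b with hab | hab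
  · have h := key a ha b hb hab β ⟨hβ, by linarith⟩
    rwa [show 1 - β = α by linarith] at h
  · have h := key b hb a ha hab α ⟨hα, by linarith⟩
    rw [show 1 - α = β by linarith, add_comm (β * b)] at h
    linarith

theorem isConsistentConvexBicombing [CompleteSpace X] (hL : L.IsConvex)
    (hg : L.IsGlobalBicombing g) : IsConsistentConvexBicombing L g where
  source := hg.apply_zero
  target := hg.apply_one
  geodesic x y s hs t ht := by
    rw [hg.lengthMetric_eq hL, hg.lengthMetric_eq hL]
    rcases le_total s t with h | h
    · rw [hg.length_sub x y hs.1 h ht.2, abs_sub_comm, abs_of_nonneg (sub_nonneg.2 h)]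
    · rw [hg.length_comm hL, hg.length_sub x y ht.1 h hs.2, abs_of_nonneg (sub_nonneg.2 h)]
  consistent x y _ _ ha hab hb _ ht := (hg.consistent x y ha hab hb ht).symm
  convex x y x' y' := by
    simp only [hg.lengthMetric_eq hL]
    exact hg.convexOn_length hL x y x' y'
  localGeodesic x y := (hg.isLocallyConsistent x y).isLocalGeodesic
  consistentWith := hg.consistentWith

end IsGlobalBicombing

end LocalGeodesicBicombing

/-- **Cartan–Hadamard theorem for convex bicombings (existence).**
A complete, simply-connected metric space with a convex local geodesic bicombing `σ` admits,
with respect to the induced length metric, a convex geodesic bicombing consistent with `σ`. -/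
theorem exists_consistent_convex_bicombing
    {X : Type*} [MetricSpace X] [CompleteSpace X] [SimplyConnectedSpace X]
    (L : LocalGeodesicBicombing X) (hL : L.IsConvex) :
    ∃ σ' : X → X → ℝ → X, IsConsistentConvexBicombing L σ' := by
  obtain ⟨g, hg⟩ := LocalGeodesicBicombing.exists_isGlobalBicombing hL
  exact ⟨g, hg.isConsistentConvexBicombing hL⟩
end

section
/- Let X be a complete metric space with a convex local geodesic bicombing σ, fix x₀ ∈ X, and let X̃_{x₀} be the set of all local geodesics c : [0,1] → X with c(0) = x₀ that are consistent with σ, equipped with the metric D(c,c′) = sup_{t∈[0,1]} d(c(t), c′(t)). Then X̃_{x₀} is contractible; an explicit contraction is given by r : X̃_{x₀} × [0,1] → X̃_{x₀}, r(c,s)(t) = c(st), which is continuous, satisfies r(c,1) = c, and r(c,0) is the constant path at x₀. -/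
open Set Metric

/-- The space `X̃_{x₀}` of local geodesics `c : [0,1] → X` with `c 0 = x₀` which are
consistent with the local geodesic bicombing `L`, as a subspace of the space of continuous
maps `C([0,1], X)` with the supremum metric `D(c, c') = sup_{t ∈ [0,1]} d(c t, c' t)`. -/
noncomputable def Xtilde {X : Type*} [MetricSpace X] (L : LocalGeodesicBicombing X) (x₀ : X) : Type _ :=
  {f : C(Icc (0:ℝ) 1, X) //
    IsLocalGeodesic (IccExtend (zero_le_one' ℝ) f) ∧
    L.ConsistentWith (IccExtend (zero_le_one' ℝ) f) ∧
    IccExtend (zero_le_one' ℝ) f 0 = x₀}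

/-- `X̃_{x₀}` carries the supremum metric `D`. -/
noncomputable instance {X : Type*} [MetricSpace X] (L : LocalGeodesicBicombing X) (x₀ : X) :
    MetricSpace (Xtilde L x₀) :=
  Subtype.metricSpace

/-- The map `exp : X̃_{x₀} → X`, `c ↦ c 1`. -/
noncomputable def expMap {X : Type*} [MetricSpace X] (L : LocalGeodesicBicombing X) (x₀ : X)
    (c : Xtilde L x₀) : X :=
  IccExtend (zero_le_one' ℝ) c.1 1

/-- A map that scales all distances in `s` by `l` has constant speed `l` on `s`. -/
theorem hasConstantSpeedOnWith_of_dist_eq {E : Type*} [PseudoMetricSpace E] {f : ℝ → E}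
    {s : Set ℝ} {l : NNReal} (h : ∀ x ∈ s, ∀ y ∈ s, dist (f x) (f y) = |x - y| * l) :
    HasConstantSpeedOnWith f s l := by
  intro x hx y hy
  have hmono : MonotoneOn (fun u : ℝ => (l : ℝ) * u) s := fun a _ b _ hab =>
    mul_le_mul_of_nonneg_left hab l.2
  have heq : eVariationOn f (s ∩ Icc x y) =
      eVariationOn (fun u : ℝ => (l : ℝ) * u) (s ∩ Icc x y) := by
    unfold eVariationOn
    congr 1 with p : 1
    refine Finset.sum_congr rfl fun i _ => ?_
    rw [edist_dist, edist_dist, h _ (p.2.2.2 _).1 _ (p.2.2.2 _).1, Real.dist_eq, ← mul_sub,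
      abs_mul, abs_of_nonneg l.coe_nonneg, mul_comm]
  rw [heq, hmono.eVariationOn_eq hx hy, mul_sub]

/-- A curve on `[0,1]` that locally scales distances by `l` has length `l`. -/
theorem curveLength_eq_of_locally_dist_eq {X : Type*} [MetricSpace X] {c : ℝ → X} {l : ℝ}
    (hl : 0 ≤ l)
    (h : ∀ t ∈ Icc (0:ℝ) 1, ∃ ε > (0:ℝ),
      ∀ s ∈ Icc (0:ℝ) 1 ∩ Ioo (t - ε) (t + ε), ∀ s' ∈ Icc (0:ℝ) 1 ∩ Ioo (t - ε) (t + ε),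
        dist (c s) (c s') = |s - s'| * l) :
    curveLength c = l := by
  lift l to NNReal using hl
  choose! ε hε hc using h
  obtain ⟨t, ht0, -, ⟨n, hn⟩, ht⟩ := exists_monotone_Icc_subset_open_cover_unitInterval
    (c := fun i : unitInterval => Subtype.val ⁻¹' Ioo ((i : ℝ) - ε i) (i + ε i))
    (fun i => isOpen_Ioo.preimage continuous_subtype_val)
    (fun i _ => mem_iUnion.2 ⟨i, by
      have := hε i i.2
      constructor <;> linarith⟩)
  have key : ∀ k, HasConstantSpeedOnWith c (Icc (0:ℝ) (t k)) l := by
    intro k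
    induction k with
    | zero =>
      apply hasConstantSpeedOnWith_of_subsingleton
      simp [ht0]
    | succ k ih =>
      refine ih.Icc_Icc (hasConstantSpeedOnWith_of_dist_eq ?_)
      obtain ⟨i, hi⟩ := ht k
      have hmem : ∀ x ∈ Icc (t k : ℝ) (t (k + 1)),
          x ∈ Icc (0:ℝ) 1 ∩ Ioo ((i : ℝ) - ε i) (i + ε i) := fun x hx =>
        have hx' : x ∈ Icc (0:ℝ) 1 := ⟨(t k).2.1.trans hx.1, hx.2.trans (t (k + 1)).2.2⟩
        ⟨hx', hi (show (⟨x, hx'⟩ : unitInterval) ∈ Icc (t k) (t (k + 1)) from hx)⟩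
      exact fun x hx y hy => hc i i.2 x (hmem x hx) y (hmem y hy)
  have h01 := key n
  rw [hn n le_rfl] at h01
  have := h01 (left_mem_Icc.2 zero_le_one) (right_mem_Icc.2 zero_le_one)
  rw [Set.Icc.coe_one, inter_self] at this
  rw [curveLength, this]
  simp

theorem mul_mem_Icc_zero_one {s u : ℝ} (hs : s ∈ Icc (0:ℝ) 1) (hu : u ∈ Icc (0:ℝ) 1) :
    s * u ∈ Icc (0:ℝ) 1 :=
  unitInterval.mul_mem hs hu

/-- An initial segment of a local geodesic, reparametrized on `[0,1]`, is a local geodesic. -/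
theorem IsLocalGeodesic.of_eqOn_comp_mul {X : Type*} [MetricSpace X] {c c' : ℝ → X}
    (hc : IsLocalGeodesic c) {s : ℝ} (hs : s ∈ Icc (0:ℝ) 1)
    (h : EqOn c' (fun u => c (s * u)) (Icc 0 1)) : IsLocalGeodesic c' := by
  have hloc : ∀ t ∈ Icc (0:ℝ) 1, ∃ ε > (0:ℝ),
      ∀ a ∈ Icc (0:ℝ) 1 ∩ Ioo (t - ε) (t + ε), ∀ b ∈ Icc (0:ℝ) 1 ∩ Ioo (t - ε) (t + ε),
        dist (c' a) (c' b) = |a - b| * (s * curveLength c) := by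
    intro t ht
    obtain ⟨ε, hε, H⟩ := hc (s * t) (mul_mem_Icc_zero_one hs ht)
    have hmem : ∀ a ∈ Icc (0:ℝ) 1 ∩ Ioo (t - ε) (t + ε),
        s * a ∈ Icc (0:ℝ) 1 ∩ Ioo (s * t - ε) (s * t + ε) := by
      rintro a ⟨ha, ha₁, ha₂⟩
      have hlt : |s * a - s * t| < ε := by
        rw [← mul_sub, abs_mul, abs_of_nonneg hs.1]
        exact (mul_le_of_le_one_left (abs_nonneg _) hs.2).trans_lt
          (abs_lt.2 ⟨by linarith, by linarith⟩)
      rw [abs_lt] at hlt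
      exact ⟨mul_mem_Icc_zero_one hs ha, by linarith, by linarith⟩
    refine ⟨ε, hε, fun a ha b hb => ?_⟩
    rw [h ha.1, h hb.1, H _ (hmem a ha) _ (hmem b hb), ← mul_sub, abs_mul, abs_of_nonneg hs.1]
    ring
  rw [IsLocalGeodesic, curveLength_eq_of_locally_dist_eq
    (mul_nonneg hs.1 ENNReal.toReal_nonneg) hloc]
  exact hloc

/-- Initial segments of curves consistent with `L` are consistent with `L`. -/
theorem LocalGeodesicBicombing.ConsistentWith.of_eqOn_comp_mul {X : Type*} [MetricSpace X]
    {L : LocalGeodesicBicombing X} {c c' : ℝ → X} (hc : L.ConsistentWith c) {s : ℝ}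
    (hs : s ∈ Icc (0:ℝ) 1) (h : EqOn c' (fun u => c (s * u)) (Icc 0 1)) :
    L.ConsistentWith c' := by
  intro a b ha hab hb hd t ht
  have ha' : a ∈ Icc (0:ℝ) 1 := ⟨ha, hab.trans hb⟩
  have hb' : b ∈ Icc (0:ℝ) 1 := ⟨ha.trans hab, hb⟩
  have hm : (1 - t) * a + t * b ∈ Icc (0:ℝ) 1 :=
    convex_Icc (0:ℝ) 1 ha' hb' (sub_nonneg.2 ht.2) ht.1 (sub_add_cancel _ _)
  rw [h ha', h hb'] at hd ⊢
  rw [h hm, ← hc (s * a) (s * b) (mul_nonneg hs.1 ha) (mul_le_mul_of_nonneg_left hab hs.1)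
    (mul_mem_Icc_zero_one hs hb').2 hd t ht]
  ring_nf

namespace Xtilde

variable {X : Type*} [MetricSpace X] {L : LocalGeodesicBicombing X} {x₀ : X}

/-- The continuous curve underlying a point of `X̃_{x₀}` depends continuously on the point. -/
theorem continuous_val : Continuous (fun c : Xtilde L x₀ => c.1) :=
  Isometry.continuous fun _ _ => rfl

/-- The map `(c, s) ↦ (t ↦ c (s t))` shrinking each curve to its starting point. -/
noncomputable def shrink (p : Xtilde L x₀ × Icc (0:ℝ) 1) : Xtilde L x₀ :=
  have hext : EqOn (IccExtend (zero_le_one' ℝ) fun t : Icc (0:ℝ) 1 =>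
        p.1.1 ⟨(p.2 : ℝ) * t, unitInterval.mul_mem p.2.2 t.2⟩)
      (fun u => IccExtend (zero_le_one' ℝ) p.1.1 (p.2 * u)) (Icc 0 1) := fun u hu => by
    dsimp only
    rw [IccExtend_of_mem _ _ hu, IccExtend_of_mem _ _ (mul_mem_Icc_zero_one p.2.2 hu)]
  ⟨⟨fun t => p.1.1 ⟨(p.2 : ℝ) * t, unitInterval.mul_mem p.2.2 t.2⟩, by fun_prop⟩,
    p.1.2.1.of_eqOn_comp_mul p.2.2 hext, p.1.2.2.1.of_eqOn_comp_mul p.2.2 hext, by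
      refine (hext (left_mem_Icc.2 zero_le_one)).trans ?_
      dsimp only
      rw [mul_zero]
      exact p.1.2.2.2⟩

theorem shrink_apply (c : Xtilde L x₀) (s t : Icc (0:ℝ) 1) :
    (shrink (c, s)).1 t = c.1 ⟨(s : ℝ) * t, unitInterval.mul_mem s.2 t.2⟩ :=
  rfl

theorem continuous_shrink : Continuous (shrink : Xtilde L x₀ × Icc (0:ℝ) 1 → Xtilde L x₀) := by
  refine Continuous.subtype_mk (ContinuousMap.continuous_of_continuous_uncurry _ ?_) _
  have h₁ : Continuous fun q : (Xtilde L x₀ × Icc (0:ℝ) 1) × Icc (0:ℝ) 1 => q.1.1.1 :=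
    continuous_val.comp (continuous_fst.comp continuous_fst)
  have h₂ : Continuous fun q : (Xtilde L x₀ × Icc (0:ℝ) 1) × Icc (0:ℝ) 1 =>
      (⟨(q.1.2 : ℝ) * q.2, unitInterval.mul_mem q.1.2.2 q.2.2⟩ : Icc (0:ℝ) 1) :=
    Continuous.subtype_mk (by fun_prop) _
  exact h₁.eval h₂

theorem shrink_one (c : Xtilde L x₀) : shrink (c, ⟨1, right_mem_Icc.2 zero_le_one⟩) = c := by
  refine Subtype.ext (ContinuousMap.ext fun t => ?_)
  simp [shrink_apply]

theorem shrink_zero_apply (c : Xtilde L x₀) (t : Icc (0:ℝ) 1) :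
    (shrink (c, ⟨0, left_mem_Icc.2 zero_le_one⟩)).1 t = x₀ := by
  have h := c.2.2.2
  rw [IccExtend_of_mem _ _ (left_mem_Icc.2 zero_le_one)] at h
  simpa [shrink_apply] using h

/-- The constant path at `x₀`. -/
noncomputable def const (L : LocalGeodesicBicombing X) (x₀ : X) : Xtilde L x₀ :=
  ⟨ContinuousMap.const _ x₀, by
    have hlen : curveLength (fun _ : ℝ => x₀) = 0 :=
      curveLength_eq_of_locally_dist_eq le_rfl fun _ _ => ⟨1, one_pos, by simp⟩
    change IsLocalGeodesic (fun _ : ℝ => x₀) ∧ L.ConsistentWith (fun _ : ℝ => x₀) ∧ x₀ = x₀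
    refine ⟨fun _ _ => ⟨1, one_pos, by simp [hlen]⟩, fun a b _ _ _ hd t ht => ?_, rfl⟩
    obtain ⟨x, hx, -⟩ := hd
    have h := L.geodesic x x₀ x₀ hx hx 0 (left_mem_Icc.2 zero_le_one) t ht
    rw [L.source x x₀ x₀ hx hx, dist_self, mul_zero] at h
    exact dist_eq_zero.1 h⟩

instance contractibleSpace : ContractibleSpace (Xtilde L x₀) := by
  rw [contractible_iff_id_nullhomotopic]
  refine ⟨const L x₀, ContinuousMap.Homotopic.symm ⟨⟨⟨fun q => shrink (q.2, q.1),
    continuous_shrink.comp continuous_swap⟩, fun c => ?_, shrink_one⟩⟩⟩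
  exact Subtype.ext (ContinuousMap.ext fun t => shrink_zero_apply c t)

end Xtilde

/-- `X̃_{x₀}` is contractible; an explicit contraction is given by the continuous map
`r : X̃_{x₀} × [0,1] → X̃_{x₀}` with `r (c, s) (t) = c (s t)`, which satisfies `r (c, 1) = c`
and `r (c, 0) = ` the constant path at `x₀`. -/
theorem Xtilde_contractible
    {X : Type*} [MetricSpace X] [CompleteSpace X]
    (L : LocalGeodesicBicombing X) (hL : L.IsConvex) (x₀ : X) :
    ContractibleSpace (Xtilde L x₀) ∧
    ∃ R : Xtilde L x₀ × Icc (0:ℝ) 1 → Xtilde L x₀,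
      Continuous R ∧
      (∀ (c : Xtilde L x₀) (s t : Icc (0:ℝ) 1),
        (R (c, s)).1 t = c.1 ⟨(s : ℝ) * (t : ℝ), unitInterval.mul_mem s.2 t.2⟩) ∧
      (∀ c : Xtilde L x₀, R (c, ⟨1, Set.right_mem_Icc.mpr zero_le_one⟩) = c) ∧
      (∀ (c : Xtilde L x₀) (t : Icc (0:ℝ) 1),
        (R (c, ⟨0, Set.left_mem_Icc.mpr zero_le_one⟩)).1 t = x₀) := by
  exact ⟨inferInstance, Xtilde.shrink, Xtilde.continuous_shrink, Xtilde.shrink_apply,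
    Xtilde.shrink_one, Xtilde.shrink_zero_apply⟩
end
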